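/- arXiv:2510.25435 — 2 statements merged into one kernel-verified Lean document; each statement's English description precedes it below -/
import Mathlib

section
/- Let Ω be a convex body in ℝⁿ containing the origin in its interior, 1 ≤ k ≤ n−1 and p ≠ n. Then Q̃_{k,n−p}(Ω,·) is a Borel measure on S^{n−1}: it vanishes on the empty set and is countably additive, i.e. for any sequence of pairwise disjoint Borel sets η_i ⊂ S^{n−1}, Q̃_{k,n−p}(Ω, ∪_{i=1}^∞ η_i) = Σ_{i=1}^∞ Q̃_{k,n−p}(Ω, η_i). -/
open MeasureTheory Real Filter Topology Set
open scoped RealInnerProductSpace NNReal ENNReal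

noncomputable section

/-- Euclidean space `ℝⁿ`. -/
abbrev En (n : ℕ) := EuclideanSpace ℝ (Fin n)

/-- The unit sphere `S^{n-1}` as a subtype. -/
abbrev Sph (n : ℕ) := Metric.sphere (0 : En n) 1

/-- Spherical Lebesgue measure on `S^{n-1}`. -/
def sphMeasure (n : ℕ) : Measure (Sph n) := (volume : Measure (En n)).toSphere

/-- Support function of a set. -/
def suppFun {n : ℕ} (Ω : Set (En n)) (x : En n) : ℝ :=
  sSup ((fun y => ⟪x, y⟫) '' Ω)

/-- Radial function of a set (0-homogeneous extension of degree -1). -/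
def radialFun {n : ℕ} (Ω : Set (En n)) (v : En n) : ℝ :=
  sSup {c : ℝ | 0 < c ∧ c • v ∈ Ω}

/-- The Hessian matrix of `u : ℝⁿ → ℝ` at `y`. -/
def hessMat {n : ℕ} (u : En n → ℝ) (y : En n) : Matrix (Fin n) (Fin n) ℝ :=
  Matrix.of fun i j =>
    iteratedFDeriv ℝ 2 u y ![EuclideanSpace.single i (1:ℝ), EuclideanSpace.single j (1:ℝ)]

/-- `S_k(A)`: the k-th elementary symmetric function of the eigenvalues of `A`,
expressed via the characteristic polynomial. -/
def esym (n k : ℕ) (A : Matrix (Fin n) (Fin n) ℝ) : ℝ :=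
  (-1 : ℝ) ^ k * (Matrix.charpoly A).coeff (n - k)

/-- Quadratic form of a matrix. -/
def quadForm {n : ℕ} (A : Matrix (Fin n) (Fin n) ℝ) (ξ : En n) : ℝ :=
  ∑ i, ∑ j, A i j * ξ i * ξ j

/-- A convex body in `ℝⁿ` containing the origin in its interior. -/
structure IsConvexBodyO (n : ℕ) (Ω : Set (En n)) : Prop where
  conv : Convex ℝ Ω
  comp : IsCompact Ω
  zeroInt : (0 : En n) ∈ interior Ω

/-- A smooth, closed, strictly convex hypersurface bounding a convex body that contains
the origin in its interior, encoded via the support function: the support function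
(which is the 1-homogeneous extension of its restriction to the sphere) is smooth away
from the origin and its Hessian is positive definite on tangent directions of the sphere. -/
structure IsSmoothStrictlyConvexBody (n : ℕ) (Ω : Set (En n)) : Prop where
  body : IsConvexBodyO n Ω
  suppSmooth : ContDiffOn ℝ (⊤ : ℕ∞) (suppFun Ω) {(0 : En n)}ᶜ
  strictConv : ∀ x : En n, ‖x‖ = 1 → ∀ ξ : En n, ⟪ξ, x⟫ = 0 → ξ ≠ 0 →
    0 < quadForm (hessMat (suppFun Ω) x) ξ

/-- An admissible (`k`-convex) solution of the `k`-Hessian Dirichlet problem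
`S_k(D²u) = 1` in `Ω`, `u = 0` on `∂Ω`. -/
structure IsAdmissibleSolution (n k : ℕ) (Ω : Set (En n)) (u : En n → ℝ) : Prop where
  smooth : ContDiff ℝ (⊤ : ℕ∞) u
  eqn : ∀ y ∈ interior Ω, esym n k (hessMat u y) = 1
  bd : ∀ y ∈ frontier Ω, u y = 0
  kconv : ∀ y ∈ interior Ω, ∀ j, 1 ≤ j → j ≤ k → 0 ≤ esym n j (hessMat u y)

/-- The property of being (a selection of) the radial Gauss map `α_Ω`:
`α v` is an outer unit normal to `∂Ω` at the boundary point `ρ_Ω(v)v`. -/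
def IsRadialGaussMap {n : ℕ} (Ω : Set (En n)) (α : Sph n → Sph n) : Prop :=
  ∀ v : Sph n, ⟪(α v : En n), radialFun Ω (v : En n) • (v : En n)⟫ = suppFun Ω (α v)

/-- The reverse radial Gauss image `α*_Ω(η)`: the set of `v` in the sphere such that
some outer unit normal of `∂Ω` at `ρ_Ω(v)v` belongs to `η`. -/
def revRadialGaussImage {n : ℕ} (Ω : Set (En n)) (η : Set (Sph n)) : Set (Sph n) :=
  {v | ∃ x ∈ η, ⟪(x : En n), radialFun Ω (v : En n) • (v : En n)⟫ = suppFun Ω (x : En n)}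

/-- The integrand `ρ_Ω(v)^{p+1-k} |Du(r_Ω(v))|^{k+1}` of the dual torsional quantities. -/
def QdualIntegrand (n k : ℕ) (p : ℝ) (Ω : Set (En n)) (u : En n → ℝ) (v : Sph n) : ℝ :=
  radialFun Ω (v : En n) ^ (p + 1 - (k : ℝ)) *
    ‖gradient u (radialFun Ω (v : En n) • (v : En n))‖ ^ (k + 1)

/-- The `p`-th dual `k`-torsional measure as a set function:
`Q̃_{k,n-p}(Ω,η) = (1/(n-p)) ∫_{α*_Ω(η)} ρ_Ω^{p+1-k} |Du(r_Ω(v))|^{k+1} dv`. -/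
def QdualSet (n k : ℕ) (p : ℝ) (Ω : Set (En n)) (u : En n → ℝ) (η : Set (Sph n)) : ℝ :=
  ((n : ℝ) - p)⁻¹ *
    ∫ v in revRadialGaussImage Ω η, QdualIntegrand n k p Ω u v ∂(sphMeasure n)

/-- The `p`-th dual `k`-torsional rigidity
`Q̃_{k,n-p}(Ω) = (1/(n-p)) ∫_{S^{n-1}} ρ_Ω^{p+1-k} |Du(r_Ω(v))|^{k+1} dv`. -/
def Qdual (n k : ℕ) (p : ℝ) (Ω : Set (En n)) (u : En n → ℝ) : ℝ :=
  ((n : ℝ) - p)⁻¹ * ∫ v, QdualIntegrand n k p Ω u v ∂(sphMeasure n)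

/-- The normalized `k`-torsional rigidity
`T̃_k(Ω) = (1/(k(n+2))) ∫_{S^{n-1}} ρ_Ω^{n+1-k} |Du(r_Ω(v))|^{k+1} dv`. -/
def Ttil (n k : ℕ) (Ω : Set (En n)) (u : En n → ℝ) : ℝ :=
  (1 / ((k : ℝ) * ((n : ℝ) + 2))) *
    ∫ v : Sph n, radialFun Ω (v : En n) ^ ((n : ℝ) + 1 - (k : ℝ)) *
      ‖gradient u (radialFun Ω (v : En n) • (v : En n))‖ ^ (k + 1) ∂(sphMeasure n)

/-- The normalization factor `η(t)` in the flow. -/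
def etaFn (n k : ℕ) (p : ℝ) (Ω : ℝ → Set (En n)) (u : ℝ → En n → ℝ) (f : En n → ℝ)
    (t : ℝ) : ℝ :=
  (∫ v, QdualIntegrand n k p (Ω t) (u t) v ∂(sphMeasure n)) /
    (∫ x : Sph n, f (x : En n) ∂(sphMeasure n))

/-- The scalar form of the flow equation (4.1)/(1.7):
`∂h/∂t = (h²/f)(|∇h|²+h²)^{(p-n)/2} |Du(∇̄h,t)|^{k+1} σ_{n-k} - η(t) h`,
written via the 1-homogeneous extension `H = suppFun (Ω t)` of the support function,
for which `∇̄h = gradient H`, `|∇h|²+h² = ‖gradient H‖²` and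
`σ_{n-k}(h_{ij}+hδ_{ij}) = S_{n-k}(D²H)`. -/
def SatisfiesFlow (n k : ℕ) (p : ℝ) (I : Set ℝ) (Ω : ℝ → Set (En n))
    (u : ℝ → En n → ℝ) (f : En n → ℝ) : Prop :=
  ∀ t ∈ I, ∀ x : En n, ‖x‖ = 1 →
    HasDerivAt (fun s => suppFun (Ω s) x)
      ((suppFun (Ω t) x) ^ 2 / f x * ‖gradient (suppFun (Ω t)) x‖ ^ (p - (n : ℝ)) *
          ‖gradient (u t) (gradient (suppFun (Ω t)) x)‖ ^ (k + 1) *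
          esym n (n - k) (hessMat (suppFun (Ω t)) x)
        - etaFn n k p Ω u f t * suppFun (Ω t) x) t

/-- Bundled hypotheses: a smooth strictly convex solution of the flow on `I`,
together with the admissible solutions of the `k`-Hessian equation on each `Ω_t`. -/
structure IsFlowSolution (n k : ℕ) (p : ℝ) (I : Set ℝ) (Ω : ℝ → Set (En n))
    (u : ℝ → En n → ℝ) (f : En n → ℝ) : Prop where
  bodies : ∀ t ∈ I, IsSmoothStrictlyConvexBody n (Ω t)
  adm : ∀ t ∈ I, IsAdmissibleSolution n k (Ω t) (u t)
  flow : SatisfiesFlow n k p I Ω u f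

end

namespace IsConvexBodyO

variable {n : ℕ} {Ω : Set (En n)}

lemma mem_nhds_zero (hΩ : IsConvexBodyO n Ω) : Ω ∈ 𝓝 (0 : En n) :=
  mem_interior_iff_mem_nhds.1 hΩ.zeroInt

lemma gauge_pos_of_ne_zero (hΩ : IsConvexBodyO n Ω) {y : En n} (hy : y ≠ 0) : 0 < gauge Ω y :=
  (_root_.gauge_pos (absorbent_nhds_zero hΩ.mem_nhds_zero)
    (NormedSpace.isVonNBounded_of_isBounded ℝ hΩ.comp.isBounded)).2 hy

lemma gauge_pos (hΩ : IsConvexBodyO n Ω) (v : Sph n) : 0 < gauge Ω (v : En n) :=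
  hΩ.gauge_pos_of_ne_zero (ne_zero_of_mem_unit_sphere v)

lemma gauge_le_one_iff (hΩ : IsConvexBodyO n Ω) (y : En n) : gauge Ω y ≤ 1 ↔ y ∈ Ω := by
  rw [gauge_le_one_iff_mem_closure hΩ.conv hΩ.mem_nhds_zero, hΩ.comp.isClosed.closure_eq]

lemma radialFun_eq_inv_gauge (hΩ : IsConvexBodyO n Ω) (v : Sph n) :
    radialFun Ω (v : En n) = (gauge Ω (v : En n))⁻¹ := by
  have hv := hΩ.gauge_pos v
  have hset : {c : ℝ | 0 < c ∧ c • (v : En n) ∈ Ω} = Ioc 0 (gauge Ω (v : En n))⁻¹ := by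
    ext c
    refine and_congr_right fun hc => ?_
    rw [← hΩ.gauge_le_one_iff, gauge_smul_of_nonneg hc.le, smul_eq_mul, ← le_div_iff₀ hv, one_div]
  rw [radialFun, hset, csSup_Ioc (inv_pos.2 hv)]

lemma radialFun_pos (hΩ : IsConvexBodyO n Ω) (v : Sph n) : 0 < radialFun Ω (v : En n) := by
  rw [hΩ.radialFun_eq_inv_gauge]
  exact inv_pos.2 (hΩ.gauge_pos v)

lemma radial_smul_mem (hΩ : IsConvexBodyO n Ω) (v : Sph n) :
    radialFun Ω (v : En n) • (v : En n) ∈ Ω := by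
  rw [← hΩ.gauge_le_one_iff, gauge_smul_of_nonneg (hΩ.radialFun_pos v).le, smul_eq_mul,
    hΩ.radialFun_eq_inv_gauge, inv_mul_cancel₀ (hΩ.gauge_pos v).ne']

lemma continuous_radialFun (hΩ : IsConvexBodyO n Ω) :
    Continuous fun v : Sph n => radialFun Ω (v : En n) := by
  simp_rw [hΩ.radialFun_eq_inv_gauge]
  exact ((continuous_gauge hΩ.conv hΩ.mem_nhds_zero).comp continuous_subtype_val).inv₀
    fun v => (hΩ.gauge_pos v).ne'

lemma continuous_radial_smul (hΩ : IsConvexBodyO n Ω) :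
    Continuous fun v : Sph n => radialFun Ω (v : En n) • (v : En n) :=
  hΩ.continuous_radialFun.smul continuous_subtype_val

lemma inner_le_suppFun (hΩ : IsConvexBodyO n Ω) (x : En n) {y : En n} (hy : y ∈ Ω) :
    ⟪x, y⟫ ≤ suppFun Ω x :=
  le_csSup (hΩ.comp.image (continuous_const.inner continuous_id)).bddAbove (mem_image_of_mem _ hy)

lemma suppFun_pos (hΩ : IsConvexBodyO n Ω) (x : Sph n) : 0 < suppFun Ω (x : En n) := by
  refine lt_of_lt_of_le ?_ (hΩ.inner_le_suppFun (x : En n) (hΩ.radial_smul_mem x))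
  rw [inner_smul_right, real_inner_self_eq_norm_sq, norm_eq_of_mem_sphere]
  simpa using hΩ.radialFun_pos x

lemma inner_le_suppFun_mul_gauge (hΩ : IsConvexBodyO n Ω) (x y : En n) :
    ⟪x, y⟫ ≤ suppFun Ω x * gauge Ω y := by
  rcases eq_or_ne y 0 with rfl | hy
  · simp
  have hg := hΩ.gauge_pos_of_ne_zero hy
  have hmem : (gauge Ω y)⁻¹ • y ∈ Ω := by
    rw [← hΩ.gauge_le_one_iff, gauge_smul_of_nonneg (inv_pos.2 hg).le, smul_eq_mul,
      inv_mul_cancel₀ hg.ne']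
  have h := hΩ.inner_le_suppFun x hmem
  rwa [inner_smul_right, inv_mul_le_iff₀ hg, mul_comm] at h

lemma inner_radial_eq_suppFun_iff (hΩ : IsConvexBodyO n Ω) (x : En n) (v : Sph n) :
    ⟪x, radialFun Ω (v : En n) • (v : En n)⟫ = suppFun Ω x ↔
      ⟪x, (v : En n)⟫ = suppFun Ω x * gauge Ω (v : En n) := by
  rw [inner_smul_right, hΩ.radialFun_eq_inv_gauge, inv_mul_eq_iff_eq_mul₀ (hΩ.gauge_pos v).ne',
    mul_comm]

/-- At a direction where the gauge is differentiable, a unit normal is a positive multiple of the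
gradient of the gauge. -/
lemma innerSL_eq_suppFun_smul_fderiv_gauge (hΩ : IsConvexBodyO n Ω) {x : En n} {v : Sph n}
    (hv : DifferentiableAt ℝ (gauge Ω) (v : En n))
    (hx : ⟪x, radialFun Ω (v : En n) • (v : En n)⟫ = suppFun Ω x) :
    innerSL ℝ x = suppFun Ω x • fderiv ℝ (gauge Ω) (v : En n) := by
  rw [hΩ.inner_radial_eq_suppFun_iff] at hx
  have hmin : IsLocalMin (fun y => suppFun Ω x * gauge Ω y - innerSL ℝ x y) (v : En n) := by
    refine Eventually.of_forall fun y => ?_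
    simp only [innerSL_apply_apply, hx, sub_self, sub_nonneg]
    exact hΩ.inner_le_suppFun_mul_gauge x y
  have h0 := hmin.hasFDerivAt_eq_zero
    ((hv.hasFDerivAt.const_mul (suppFun Ω x)).sub (innerSL ℝ x).hasFDerivAt)
  exact (sub_eq_zero.1 h0).symm

lemma unit_normal_unique (hΩ : IsConvexBodyO n Ω) {x x' v : Sph n}
    (hv : DifferentiableAt ℝ (gauge Ω) (v : En n))
    (hx : ⟪(x : En n), radialFun Ω (v : En n) • (v : En n)⟫ = suppFun Ω (x : En n))
    (hx' : ⟪(x' : En n), radialFun Ω (v : En n) • (v : En n)⟫ = suppFun Ω (x' : En n)) :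
    x = x' := by
  have h := hΩ.innerSL_eq_suppFun_smul_fderiv_gauge hv hx
  have h' := hΩ.innerSL_eq_suppFun_smul_fderiv_gauge hv hx'
  have hpos := hΩ.suppFun_pos x
  have hpos' := hΩ.suppFun_pos x'
  have hsmul : suppFun Ω (x' : En n) • (x : En n) = suppFun Ω (x : En n) • (x' : En n) := by
    apply (innerSL_inj (𝕜 := ℝ)).1
    rw [map_smul, map_smul, h, h', smul_comm]
  have hnorm := congrArg norm hsmul
  rw [norm_smul, norm_smul, norm_eq_of_mem_sphere, norm_eq_of_mem_sphere, mul_one, mul_one,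
    Real.norm_of_nonneg hpos.le, Real.norm_of_nonneg hpos'.le] at hnorm
  rw [hnorm] at hsmul
  exact Subtype.ext (smul_right_injective _ hpos.ne' hsmul)

lemma ae_differentiableAt_gauge (hΩ : IsConvexBodyO n Ω) :
    ∀ᵐ v : Sph n ∂sphMeasure n, DifferentiableAt ℝ (gauge Ω) (v : En n) := by
  obtain ⟨K, hK⟩ := hΩ.conv.lipschitz_gauge hΩ.mem_nhds_zero
  have hae : volume {y : En n | ¬ DifferentiableAt ℝ (gauge Ω) y} = 0 :=
    ae_iff.1 hK.ae_differentiableAt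
  have hmeas : MeasurableSet {v : Sph n | ¬ DifferentiableAt ℝ (gauge Ω) (v : En n)} :=
    ((measurableSet_of_differentiableAt ℝ (gauge Ω)).preimage measurable_subtype_coe).compl
  rw [ae_iff, sphMeasure, Measure.toSphere_apply' volume hmeas]
  refine mul_eq_zero_of_right _ (measure_mono_null ?_ hae)
  rintro _ ⟨c, hc, _, ⟨v, hv, rfl⟩, rfl⟩ hd
  refine hv ?_
  have hcomp : DifferentiableAt ℝ (fun y => c⁻¹ * gauge Ω (c • y)) (v : En n) :=
    (DifferentiableAt.comp (v : En n) (g := gauge Ω) hd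
      (differentiableAt_id.const_smul c)).const_mul c⁻¹
  refine hcomp.congr_of_eventuallyEq (Eventually.of_forall fun y => ?_)
  simp only [gauge_smul_of_nonneg hc.1.le, smul_eq_mul, inv_mul_cancel_left₀ hc.1.ne']

lemma isClosed_revRadialGaussImage (hΩ : IsConvexBodyO n Ω) {η : Set (Sph n)} (hη : IsClosed η) :
    IsClosed (revRadialGaussImage Ω η) := by
  have hsupp (x : En n) (v : Sph n) :
      ⟪x, radialFun Ω (v : En n) • (v : En n)⟫ = suppFun Ω x ↔
        ∀ y ∈ Ω, ⟪x, y⟫ ≤ ⟪x, radialFun Ω (v : En n) • (v : En n)⟫ := by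
    refine ⟨fun h y hy => h ▸ hΩ.inner_le_suppFun x hy, fun h => le_antisymm
      (hΩ.inner_le_suppFun x (hΩ.radial_smul_mem v)) (csSup_le ?_ ?_)⟩
    · exact ⟨_, mem_image_of_mem _ (hΩ.radial_smul_mem v)⟩
    · rintro _ ⟨y, hy, rfl⟩
      exact h y hy
  have hclosed : IsClosed {q : Sph n × Sph n | q.1 ∈ η ∧ ∀ y ∈ Ω,
      ⟪(q.1 : En n), y⟫ ≤ ⟪(q.1 : En n), radialFun Ω (q.2 : En n) • (q.2 : En n)⟫} := by
    have hfst : Continuous fun q : Sph n × Sph n => (q.1 : En n) :=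
      continuous_subtype_val.comp continuous_fst
    simp only [ofPred_and, ofPred_forall]
    refine (hη.preimage continuous_fst).inter ?_
    exact isClosed_biInter fun y _ => isClosed_le (hfst.inner continuous_const)
      (hfst.inner (hΩ.continuous_radial_smul.comp continuous_snd))
  convert! isClosedMap_snd_of_compactSpace _ hclosed using 1
  ext v
  simp [revRadialGaussImage, hsupp]

lemma revRadialGaussImage_iUnion {ι : Sort*} (Ω : Set (En n)) (η : ι → Set (Sph n)) :
    revRadialGaussImage Ω (⋃ i, η i) = ⋃ i, revRadialGaussImage Ω (η i) := by
  ext v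
  simp only [revRadialGaussImage, mem_iUnion, mem_ofPred_eq]
  grind

lemma aedisjoint_revRadialGaussImage (hΩ : IsConvexBodyO n Ω) {η η' : Set (Sph n)}
    (h : Disjoint η η') :
    AEDisjoint (sphMeasure n) (revRadialGaussImage Ω η) (revRadialGaussImage Ω η') := by
  have hnull : sphMeasure n {v : Sph n | ¬ DifferentiableAt ℝ (gauge Ω) (v : En n)} = 0 :=
    ae_iff.1 hΩ.ae_differentiableAt_gauge
  refine measure_mono_null ?_ hnull
  rintro v ⟨⟨x, hx, hxv⟩, x', hx', hxv'⟩ hd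
  exact h.ne_of_mem hx hx' (hΩ.unit_normal_unique hd hxv hxv')

lemma nullMeasurableSet_revRadialGaussImage_compl (hΩ : IsConvexBodyO n Ω) {η : Set (Sph n)}
    (hη : NullMeasurableSet (revRadialGaussImage Ω η) (sphMeasure n)) :
    NullMeasurableSet (revRadialGaussImage Ω ηᶜ) (sphMeasure n) := by
  have hunion : revRadialGaussImage Ω univ =
      revRadialGaussImage Ω ηᶜ ∪ revRadialGaussImage Ω η := by
    rw [← compl_union_self η, union_eq_iUnion, revRadialGaussImage_iUnion, union_eq_iUnion]
    exact iUnion_congr fun b => by cases b <;> rfl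
  have hsplit : revRadialGaussImage Ω ηᶜ = (revRadialGaussImage Ω univ \ revRadialGaussImage Ω η) ∪
      (revRadialGaussImage Ω ηᶜ ∩ revRadialGaussImage Ω η) := by
    rw [hunion, union_sdiff_right, sdiff_union_inter]
  rw [hsplit]
  exact (NullMeasurableSet.diff
    (hΩ.isClosed_revRadialGaussImage isClosed_univ).nullMeasurableSet hη).union
    (NullMeasurableSet.of_null (hΩ.aedisjoint_revRadialGaussImage disjoint_compl_left))

lemma nullMeasurableSet_revRadialGaussImage (hΩ : IsConvexBodyO n Ω) {η : Set (Sph n)}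
    (hη : MeasurableSet η) : NullMeasurableSet (revRadialGaussImage Ω η) (sphMeasure n) := by
  induction η, hη using MeasurableSet.induction_on_open with
  | isOpen U hU =>
    rw [← compl_compl U]
    exact hΩ.nullMeasurableSet_revRadialGaussImage_compl
      (hΩ.isClosed_revRadialGaussImage hU.isClosed_compl).nullMeasurableSet
  | compl t _ ih => exact hΩ.nullMeasurableSet_revRadialGaussImage_compl ih
  | iUnion f _ _ ih =>
    rw [revRadialGaussImage_iUnion]
    exact NullMeasurableSet.iUnion ih

end IsConvexBodyO

lemma continuous_QdualIntegrand {n : ℕ} {Ω : Set (En n)} (hΩ : IsConvexBodyO n Ω) (k : ℕ) (p : ℝ)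
    {u : En n → ℝ} (hu : ContDiff ℝ 1 u) : Continuous (QdualIntegrand n k p Ω u) := by
  have hgrad : Continuous (gradient u) :=
    (InnerProductSpace.toDual ℝ (En n)).symm.continuous.comp (hu.continuous_fderiv one_ne_zero)
  exact (hΩ.continuous_radialFun.rpow_const fun v => Or.inl (hΩ.radialFun_pos v).ne').mul
    ((hgrad.comp hΩ.continuous_radial_smul).norm.pow (k + 1))

/-- **`Q̃_{k,n-p}(Ω,·)` is a Borel measure (Lemma 3.6).**
For a convex body `Ω` containing the origin in its interior, `1 ≤ k ≤ n-1` and `p ≠ n`,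
the set function `Q̃_{k,n-p}(Ω,·)` vanishes on the empty set and is countably additive on
pairwise disjoint Borel subsets of the sphere. -/
theorem Qdual_is_measure (n k : ℕ) (p : ℝ) (hk1 : 1 ≤ k) (hkn : k ≤ n - 1)
    (hp : p ≠ (n : ℝ))
    (Ω : Set (En n)) (hΩ : IsConvexBodyO n Ω)
    (u : En n → ℝ) (hu : IsAdmissibleSolution n k Ω u) :
    QdualSet n k p Ω u ∅ = 0 ∧
    ∀ η : ℕ → Set (Sph n), (∀ i, MeasurableSet (η i)) →
      Pairwise (Function.onFun Disjoint η) →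
      QdualSet n k p Ω u (⋃ i, η i) = ∑' i, QdualSet n k p Ω u (η i) := by
  refine ⟨by simp [QdualSet, revRadialGaussImage], fun η hη hdisj => ?_⟩
  have hint : Integrable (QdualIntegrand n k p Ω u) (sphMeasure n) := by
    have : IsFiniteMeasure (sphMeasure n) := by unfold sphMeasure; infer_instance
    have hcont := continuous_QdualIntegrand hΩ k p (hu.smooth.of_le (by simp))
    exact hcont.integrable_of_hasCompactSupport (HasCompactSupport.of_compactSpace _)
  simp only [QdualSet]
  rw [IsConvexBodyO.revRadialGaussImage_iUnion, integral_iUnion_ae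
    (fun i => hΩ.nullMeasurableSet_revRadialGaussImage (hη i))
    (fun i j hij => hΩ.aedisjoint_revRadialGaussImage (hdisj hij)) hint.integrableOn, tsum_mul_left]
end

section
/- Let 1 ≤ k ≤ n−1 and p < n−2. Let ∂Ω_t be a smooth strictly convex solution of the flow ∂h/∂t = (h²/f)ρ^{p−n}|Du|^{k+1}σ_{n−k} − η(t)h on [0,T) with uniform two-sided bounds on h, ρ, |∇h|, η(t), |Du| and |D²u| along the flow, with u(·,t) the smooth admissible solution of S_k(D²u)=1 in Ω_t and f positive smooth on S^{n−1}. Then there exists a constant C₀ > 0 independent of t such that σ_{n−k}(x,t) ≥ C₀ for all (x,t) ∈ S^{n−1} × [0,T). -/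
open MeasureTheory Real Filter Topology Set
open scoped RealInnerProductSpace NNReal ENNReal

theorem splits_derivative_of_splits {p : Polynomial ℝ} (hp : p.Splits) :
    (Polynomial.derivative p).Splits := by
  by_cases h0 : p.natDegree = 0
  · rw [Polynomial.natDegree_eq_zero.mp h0 |>.choose_spec.symm]
    simp
  rw [Polynomial.splits_iff_card_roots] at hp ⊢
  have h1 := Polynomial.card_roots_le_derivative p
  have h2 := Polynomial.card_roots' (Polynomial.derivative p)
  have h3 := Polynomial.natDegree_derivative_lt h0
  omega

theorem splits_iterate_derivative {p : Polynomial ℝ} (hp : p.Splits) (m : ℕ) :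
    (Polynomial.derivative^[m] p).Splits := by
  induction m with
  | zero => simpa using hp
  | succ m ih =>
    rw [Function.iterate_succ_apply']
    exact splits_derivative_of_splits ih

/-- A real-rooted polynomial which is positive to the right of `b` has positive derivative
at `b`. -/
theorem derivative_eval_pos_of_splits {p : Polynomial ℝ} (hp : p.Splits) {b : ℝ}
    (hd : p.natDegree ≠ 0) (hpos : ∀ t, b ≤ t → 0 < p.eval t) :
    0 < (Polynomial.derivative p).eval b := by
  have hb := hpos b le_rfl
  have h := hp.eval_derivative_div_eval_of_ne_zero hb.ne'
  have hsum : 0 < (p.roots.map fun z => 1 / (b - z)).sum := by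
    have hcard := Polynomial.splits_iff_card_roots.mp hp
    have hpos' : ∀ z ∈ p.roots, 0 < 1 / (b - z) := by
      intro z hz
      have hz' : p.eval z = 0 := (Polynomial.mem_roots'.mp hz).2
      have : z < b := by
        by_contra! hle
        exact (hpos z hle).ne' hz'
      exact one_div_pos.mpr (sub_pos.mpr this)
    have hne : p.roots ≠ ∅ := by
      intro h0
      rw [h0] at hcard
      exact hd (by simpa using hcard.symm)
    have := Multiset.sum_lt_sum_of_nonempty (f := fun _ : ℝ => (0 : ℝ))
      (g := fun z => 1 / (b - z)) hne hpos'
    simpa using this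
  rw [← h] at hsum
  exact (div_pos_iff_of_pos_right hb).mp hsum

theorem exists_greatest_root {p : Polynomial ℝ} (hlead : 0 < p.leadingCoeff)
    (h0 : p.eval 0 < 0) :
    ∃ b, 0 < b ∧ p.eval b = 0 ∧ ∀ t, b < t → 0 < p.eval t := by
  have hdeg : 0 < p.degree := by
    by_contra! hle
    rw [Polynomial.eq_C_of_degree_le_zero hle] at h0 hlead
    simp at h0 hlead
    linarith
  have htop := p.tendsto_atTop_of_leadingCoeff_nonneg hdeg hlead.le
  have hroot : ∀ s, p.eval s ≤ 0 → ∃ t, s ≤ t ∧ p.eval t = 0 := by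
    intro s hs
    obtain ⟨T, hT1, hT2⟩ :=
      ((htop.eventually_ge_atTop 0).and (eventually_ge_atTop s)).exists
    obtain ⟨t, ht, ht0⟩ := intermediate_value_Icc hT2 p.continuous.continuousOn ⟨hs, hT1⟩
    exact ⟨t, ht.1, ht0⟩
  have hp : p ≠ 0 := by rintro rfl; simp at hlead
  obtain ⟨t0, ht0, ht0'⟩ := hroot 0 h0.le
  have hne : p.roots.toFinset.Nonempty := ⟨t0, by simp [hp, ht0']⟩
  have hmem : p.eval (p.roots.toFinset.max' hne) = 0 := by
    have := p.roots.toFinset.max'_mem hne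
    simpa [hp] using this
  have hmax : ∀ t, p.eval t = 0 → t ≤ p.roots.toFinset.max' hne := fun t ht =>
    Finset.le_max' _ _ (by simp [hp, ht])
  refine ⟨_, ?_, hmem, fun t ht => ?_⟩
  · have h1 := hmax t0 ht0'
    have h2 : t0 ≠ 0 := by rintro rfl; linarith
    have h3 := lt_of_le_of_ne ht0 h2.symm
    linarith
  · by_contra! hle
    obtain ⟨s, hs, hs0⟩ := hroot t hle
    linarith [hmax s hs0]

theorem coeff_nonneg_of_coeff_X_add_C_mul_nonneg {g : Polynomial ℝ} (hg : g.Splits)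
    (hlead : 0 < g.leadingCoeff) (a : ℝ) {m : ℕ} (hm : 1 ≤ m)
    (hf : ∀ j, m ≤ j → 0 ≤ ((Polynomial.X + Polynomial.C a) * g).coeff j) :
    0 ≤ g.coeff m := by
  by_contra! hneg
  obtain ⟨r, rfl⟩ : ∃ r, m = r + 1 := ⟨m - 1, by omega⟩
  set P := Polynomial.derivative^[r] g with hP
  set f := (Polynomial.X + Polynomial.C a) * g with hfdef
  have hGP : Polynomial.derivative P = Polynomial.derivative^[r + 1] g := by
    rw [Function.iterate_succ_apply']
  have hdeg : r + 1 ≤ g.natDegree := by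
    by_contra! hlt
    rw [Polynomial.coeff_eq_zero_of_natDegree_lt hlt] at hneg
    exact lt_irrefl _ hneg
  have hdegG : (Polynomial.derivative P).natDegree ≤ g.natDegree - (r + 1) := by
    rw [hGP]; exact Polynomial.natDegree_iterate_derivative g (r + 1)
  have hG0 : (Polynomial.derivative P).eval 0 < 0 := by
    rw [← Polynomial.coeff_zero_eq_eval_zero, hGP, Polynomial.coeff_iterate_derivative]
    simp only [zero_add, nsmul_eq_mul]
    exact mul_neg_of_pos_of_neg (by rw [Nat.descFactorial_self]; positivity) hneg
  have hGlead : 0 < (Polynomial.derivative P).leadingCoeff := by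
    have hc : 0 < (Polynomial.derivative P).coeff (g.natDegree - (r + 1)) := by
      rw [hGP, Polynomial.coeff_iterate_derivative, Nat.sub_add_cancel hdeg, nsmul_eq_mul]
      refine mul_pos ?_ hlead
      exact_mod_cast Nat.descFactorial_pos.mpr hdeg
    rwa [Polynomial.leadingCoeff,
      le_antisymm hdegG (Polynomial.le_natDegree_of_ne_zero hc.ne')]
  obtain ⟨b, hb, hb0, hbpos⟩ := exists_greatest_root hGlead hG0
  have hfm : (Polynomial.derivative^[r + 1] f).eval b = (r + 1) * P.eval b := by
    have h : Polynomial.derivative^[r + 1] f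
        = (Polynomial.X + Polynomial.C a) * Polynomial.derivative P + (r + 1) • P := by
      rw [hGP, hfdef, add_mul, mul_comm, iterate_map_add,
        Polynomial.iterate_derivative_mul_X, Polynomial.iterate_derivative_C_mul]
      simp only [Nat.add_sub_cancel]
      ring
    rw [h]
    simp [hb0]
  have hfpos : 0 < (Polynomial.derivative^[r + 1] f).eval b := by
    rw [Polynomial.eval_eq_sum_range]
    have hfne : f ≠ 0 := by
      refine mul_ne_zero (Polynomial.X_add_C_ne_zero a) ?_
      rintro rfl; simp at hlead
    have hnd : f.natDegree = g.natDegree + 1 := by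
      rw [hfdef, Polynomial.natDegree_mul (Polynomial.X_add_C_ne_zero a)
        (by rintro rfl; simp at hlead), Polynomial.natDegree_X_add_C, add_comm]
    have hcoef : ∀ j, 0 ≤ (Polynomial.derivative^[r + 1] f).coeff j := by
      intro j
      rw [Polynomial.coeff_iterate_derivative]
      exact nsmul_nonneg (hf _ (by omega)) _
    refine Finset.sum_pos' (fun j _ => mul_nonneg (hcoef j) (by positivity))
      ⟨(Polynomial.derivative^[r + 1] f).natDegree, by simp, ?_⟩
    refine mul_pos (lt_of_le_of_ne (hcoef _) (Ne.symm ?_)) (by positivity)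
    rw [Polynomial.coeff_natDegree, Polynomial.leadingCoeff_ne_zero]
    intro h
    have h2 : (Polynomial.derivative^[r + 1] f).coeff (f.natDegree - (r + 1)) = 0 := by
      rw [h]; simp
    rw [Polynomial.coeff_iterate_derivative, Nat.sub_add_cancel (by omega), nsmul_eq_mul] at h2
    have h3 : f.coeff f.natDegree ≠ 0 := by
      rw [Polynomial.coeff_natDegree]; exact Polynomial.leadingCoeff_ne_zero.mpr hfne
    have h4 : ((f.natDegree.descFactorial (r + 1) : ℕ) : ℝ) ≠ 0 := by
      exact_mod_cast (Nat.descFactorial_pos.mpr (by omega)).ne'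
    exact mul_ne_zero h4 h3 h2
  have hPb : 0 < P.eval b := by
    rw [hfm] at hfpos
    exact pos_of_mul_pos_right hfpos (by positivity)
  have hPdeg : P.natDegree ≠ 0 := by
    intro h
    rw [Polynomial.natDegree_eq_zero] at h
    obtain ⟨c, hc⟩ := h
    rw [← hc] at hG0
    simp at hG0
  have hmono : ∀ t, b ≤ t → 0 < P.eval t := by
    intro t ht
    have : MonotoneOn (fun t => P.eval t) (Set.Ici b) := by
      apply monotoneOn_of_deriv_nonneg (convex_Ici b) P.continuous.continuousOn
        P.differentiable.differentiableOn
      intro x hx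
      rw [interior_Ici] at hx
      rw [Polynomial.deriv]
      exact (hbpos x hx).le
    exact hPb.trans_le (this (Set.mem_Ici.mpr le_rfl) ht ht)
  have := derivative_eval_pos_of_splits (splits_iterate_derivative hg r) hPdeg hmono
  exact this.ne' hb0

theorem prod_X_sub_C_coeff_sign {ι : Type*} (s : Finset ι) (d : ι → ℝ) {k : ℕ} (hk : k ≤ s.card) :
    (-1 : ℝ) ^ k * (∏ i ∈ s, (Polynomial.X - Polynomial.C (d i))).coeff (s.card - k)
      = (∏ i ∈ s, (Polynomial.X + Polynomial.C (d i))).coeff (s.card - k) := by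
  have h1 := Multiset.prod_X_sub_C_coeff (s.val.map d) (k := s.card - k) (by simp)
  have h2 := Multiset.prod_X_add_C_coeff (s.val.map d) (k := s.card - k) (by simp)
  simp only [Multiset.map_map, Multiset.card_map, Finset.card_val, Nat.sub_sub_self hk] at h1 h2
  have e1 : ∏ i ∈ s, (Polynomial.X - Polynomial.C (d i))
      = (s.val.map ((fun t => Polynomial.X - Polynomial.C t) ∘ d)).prod := rfl
  have e2 : ∏ i ∈ s, (Polynomial.X + Polynomial.C (d i))
      = (s.val.map ((fun t => Polynomial.X + Polynomial.C t) ∘ d)).prod := rfl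
  rw [e1, e2, h1, h2, ← mul_assoc, ← mul_pow]
  simp

theorem esym_eq_coeff_prod {n k : ℕ} (hk : k ≤ n) {A : Matrix (Fin n) (Fin n) ℝ}
    (hA : A.IsHermitian) :
    esym n k A
      = (∏ i, (Polynomial.X + Polynomial.C (hA.eigenvalues i))).coeff (n - k) := by
  have h := prod_X_sub_C_coeff_sign Finset.univ hA.eigenvalues (k := k) (by simpa using hk)
  rw [Finset.card_univ, Fintype.card_fin] at h
  rw [← h, esym, hA.charpoly_eq]
  rfl

theorem det_diagonal_sub_vecMulVec {ι : Type*} [Fintype ι] [DecidableEq ι] (d w : ι → ℝ)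
    (hd : ∀ i, d i ≠ 0) :
    (Matrix.diagonal d - Matrix.vecMulVec w w).det
      = ∏ i, d i - ∑ i, w i ^ 2 * ∏ j ∈ Finset.univ.erase i, d j := by
  have hu : IsUnit (Matrix.diagonal d).det := by
    rw [Matrix.det_diagonal]
    exact (Finset.prod_ne_zero_iff.mpr fun i _ => hd i).isUnit
  have hmul : Matrix.diagonal d * Matrix.diagonal (fun i => (d i)⁻¹) = 1 := by
    rw [Matrix.diagonal_mul_diagonal, ← Matrix.diagonal_one]
    congr 1
    ext i
    exact mul_inv_cancel₀ (hd i)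
  have hinv : (Matrix.diagonal d)⁻¹ = Matrix.diagonal (fun i => (d i)⁻¹) :=
    Matrix.inv_eq_right_inv hmul
  have h1 : Matrix.diagonal d - Matrix.vecMulVec w w
      = Matrix.diagonal d + Matrix.replicateCol Unit (-w) * Matrix.replicateRow Unit w := by
    rw [← Matrix.vecMulVec_eq, Matrix.neg_vecMulVec, sub_eq_add_neg]
  rw [h1, Matrix.det_add_replicateCol_mul_replicateRow hu, Matrix.det_diagonal, hinv,
    Matrix.det_unique]
  simp only [Matrix.add_apply, Matrix.one_apply_eq, Matrix.mul_apply, Matrix.replicateRow_apply,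
    Matrix.replicateCol_apply, Matrix.diagonal_apply, mul_ite, mul_zero,
    Finset.sum_ite_eq', Finset.mem_univ, if_true, Pi.neg_apply]
  rw [mul_add, mul_one, sub_eq_add_neg, ← Finset.sum_neg_distrib, Finset.mul_sum]
  congr 1
  refine Finset.sum_congr rfl fun i _ => ?_
  rw [← Finset.mul_prod_erase Finset.univ d (Finset.mem_univ i)]
  field_simp [hd i]

theorem charpoly_diagonal_add_vecMulVec {ι : Type*} [Fintype ι] [DecidableEq ι] (d w : ι → ℝ) :
    (Matrix.diagonal d + Matrix.vecMulVec w w).charpoly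
      = ∏ i, (Polynomial.X - Polynomial.C (d i))
        - ∑ i, Polynomial.C (w i ^ 2)
          * ∏ j ∈ Finset.univ.erase i, (Polynomial.X - Polynomial.C (d j)) := by
  apply Polynomial.eq_of_infinite_eval_eq
  refine Set.Infinite.mono ?_ (Set.Finite.infinite_compl (Set.finite_range d))
  intro t ht
  have hd : ∀ i, t - d i ≠ 0 := fun i h => ht ⟨i, by linarith⟩
  have h := det_diagonal_sub_vecMulVec (fun i => t - d i) w hd
  simp only [Set.mem_ofPred_eq, Matrix.eval_charpoly, Polynomial.eval_sub, Polynomial.eval_prod,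
    Polynomial.eval_finsetSum, Polynomial.eval_mul, Polynomial.eval_X, Polynomial.eval_C]
  rw [← h]
  congr 1
  rw [Matrix.scalar_apply, ← sub_sub, Matrix.diagonal_sub]

theorem esym_add_vecMulVec {n k : ℕ} (hk1 : 1 ≤ k) (hk : k ≤ n) {A : Matrix (Fin n) (Fin n) ℝ}
    (hA : A.IsHermitian) (v : Fin n → ℝ) :
    ∃ w : Fin n → ℝ, esym n k (A + Matrix.vecMulVec v v) = esym n k A + ∑ i, w i ^ 2 *
      (∏ j ∈ Finset.univ.erase i,
        (Polynomial.X + Polynomial.C (hA.eigenvalues j))).coeff (n - k) := by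
  set U : Matrix (Fin n) (Fin n) ℝ := (hA.eigenvectorUnitary : Matrix (Fin n) (Fin n) ℝ) with hU
  have hUU : star U * U = 1 := Unitary.coe_star_mul_self hA.eigenvectorUnitary
  have hUU' : U * star U = 1 := Unitary.coe_mul_star_self hA.eigenvectorUnitary
  have hspec : A = U * Matrix.diagonal hA.eigenvalues * star U := by
    conv_lhs => rw [hA.spectral_theorem, Unitary.conjStarAlgAut_apply]
    rfl
  set w := Matrix.mulVec (star U) v with hw
  refine ⟨w, ?_⟩
  have hv : Matrix.vecMulVec v v = U * Matrix.vecMulVec w w * star U := by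
    rw [Matrix.mul_vecMulVec, Matrix.vecMulVec_mul, hw, Matrix.mulVec_mulVec, hUU',
      Matrix.one_mulVec]
    congr 1
    rw [Matrix.star_eq_conjTranspose, Matrix.conjTranspose_eq_transpose_of_trivial,
      Matrix.vecMul_transpose, Matrix.mulVec_mulVec]
    rw [Matrix.star_eq_conjTranspose, Matrix.conjTranspose_eq_transpose_of_trivial] at hUU'
    rw [hUU', Matrix.one_mulVec]
  have hcp : (A + Matrix.vecMulVec v v).charpoly
      = (Matrix.diagonal hA.eigenvalues + Matrix.vecMulVec w w).charpoly := by
    have : A + Matrix.vecMulVec v v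
        = U * (Matrix.diagonal hA.eigenvalues + Matrix.vecMulVec w w) * star U := by
      rw [mul_add, add_mul, ← hspec, ← hv]
    rw [this, Matrix.charpoly_mul_comm, ← mul_assoc, hUU, one_mul]
  have h1 := prod_X_sub_C_coeff_sign Finset.univ hA.eigenvalues (k := k) (by simpa using hk)
  rw [Finset.card_univ, Fintype.card_fin] at h1
  rw [esym_eq_coeff_prod hk hA, ← h1, esym, hcp, charpoly_diagonal_add_vecMulVec,
    Polynomial.coeff_sub, mul_sub, sub_eq_add_neg, Polynomial.finsetSum_coeff, Finset.mul_sum,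
    ← Finset.sum_neg_distrib]
  congr 1
  refine Finset.sum_congr rfl fun i _ => ?_
  have h2 := prod_X_sub_C_coeff_sign (Finset.univ.erase i) hA.eigenvalues (k := k - 1)
    (by simp; omega)
  rw [Finset.card_erase_of_mem (Finset.mem_univ i), Finset.card_univ, Fintype.card_fin,
    show n - 1 - (k - 1) = n - k by omega] at h2
  rw [← h2, Polynomial.coeff_C_mul]
  obtain ⟨r, rfl⟩ : ∃ r, k = r + 1 := ⟨k - 1, by omega⟩
  simp only [Nat.add_sub_cancel, pow_succ]
  ring

theorem esym_zero {n : ℕ} (A : Matrix (Fin n) (Fin n) ℝ) : esym n 0 A = 1 := by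
  have h : A.charpoly.coeff A.charpoly.natDegree = 1 := A.charpoly_monic
  have hd := A.charpoly_natDegree_eq_dim
  rw [Fintype.card_fin] at hd
  rw [hd] at h
  simpa only [esym, pow_zero, one_mul, Nat.sub_zero] using h

/-- In the closed Gårding cone, the elementary symmetric functions of the eigenvalues do not
decrease under a positive rank-one perturbation. -/
theorem esym_le_esym_add_vecMulVec {n k : ℕ} (hk : k + 1 ≤ n) {A : Matrix (Fin n) (Fin n) ℝ}
    (hA : A.IsHermitian) (hpos : ∀ j ≤ k, 0 ≤ esym n j A) (v : Fin n → ℝ) :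
    ∀ j ≤ k, esym n j A ≤ esym n j (A + Matrix.vecMulVec v v) := by
  intro j hj
  rcases Nat.eq_zero_or_pos j with rfl | hj0
  · simp [esym_zero]
  obtain ⟨w, hw⟩ := esym_add_vecMulVec (k := j) hj0 (by omega) hA v
  rw [hw]
  refine le_add_of_nonneg_right (Finset.sum_nonneg fun i _ => mul_nonneg (sq_nonneg _) ?_)
  have hmonic : (∏ j ∈ Finset.univ.erase i,
      (Polynomial.X + Polynomial.C (hA.eigenvalues j))).Monic :=
    Polynomial.monic_prod_of_monic _ _ fun j _ => Polynomial.monic_X_add_C _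
  refine coeff_nonneg_of_coeff_X_add_C_mul_nonneg
    (Polynomial.Splits.prod fun j _ => Polynomial.Splits.X_add_C _) (by rw [hmonic]; norm_num)
    (hA.eigenvalues i) (by omega) fun l hl => ?_
  rw [Finset.mul_prod_erase Finset.univ
    (fun j => Polynomial.X + Polynomial.C (hA.eigenvalues j)) (Finset.mem_univ i)]
  by_cases hln : l ≤ n
  · have := esym_eq_coeff_prod (k := n - l) (by omega) hA
    rw [Nat.sub_sub_self hln] at this
    rw [← this]
    exact hpos _ (by omega)
  · rw [Polynomial.coeff_eq_zero_of_natDegree_lt]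
    rw [Polynomial.natDegree_prod_of_monic _ _ fun j _ => Polynomial.monic_X_add_C _]
    simp
    omega

theorem isHermitian_vecMulVec_self {n : ℕ} (v : Fin n → ℝ) :
    (Matrix.vecMulVec v v).IsHermitian := by
  ext i j
  simp [Matrix.vecMulVec_apply, mul_comm]

theorem esym_le_esym_add_posSemidef {n k : ℕ} (hk : k + 1 ≤ n) {A P : Matrix (Fin n) (Fin n) ℝ}
    (hA : A.IsHermitian) (hpos : ∀ j ≤ k, 0 ≤ esym n j A) (hP : P.PosSemidef) :
    ∀ j ≤ k, esym n j A ≤ esym n j (A + P) := by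
  obtain ⟨m, a, rfl⟩ := Matrix.posSemidef_iff_eq_sum_vecMulVec.mp hP
  simp only [star_trivial]
  have key : ∀ s : Finset (Fin m), (A + ∑ i ∈ s, Matrix.vecMulVec (a i) (a i)).IsHermitian ∧
      ∀ j ≤ k, esym n j A ≤ esym n j (A + ∑ i ∈ s, Matrix.vecMulVec (a i) (a i)) := by
    intro s
    induction s using Finset.induction_on with
    | empty => simpa using hA
    | insert i s hi ih =>
      rw [Finset.sum_insert hi, add_comm (Matrix.vecMulVec _ _), ← add_assoc]
      refine ⟨ih.1.add (isHermitian_vecMulVec_self _), fun j hj => (ih.2 j hj).trans ?_⟩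
      exact esym_le_esym_add_vecMulVec hk ih.1
        (fun j hj => (hpos j hj).trans (ih.2 j hj)) _ j hj
  exact (key Finset.univ).2

theorem esym_zero_matrix {n k : ℕ} (hk1 : 1 ≤ k) (hk : k ≤ n) :
    esym n k (0 : Matrix (Fin n) (Fin n) ℝ) = 0 := by
  rw [esym, Matrix.charpoly_zero, Fintype.card_fin, Polynomial.coeff_X_pow, if_neg (by omega),
    mul_zero]

theorem esym_nonneg_of_posSemidef {n : ℕ} {A : Matrix (Fin n) (Fin n) ℝ}
    (hA : A.PosSemidef) {j : ℕ} (hj : j ≤ n) : 0 ≤ esym n j A := by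
  rw [esym_eq_coeff_prod hj hA.isHermitian, Finset.prod_X_add_C_coeff _ _ (by simp)]
  exact Finset.sum_nonneg fun t _ => Finset.prod_nonneg fun i _ => hA.eigenvalues_nonneg i

theorem esym_smul {n k : ℕ} (hk : k ≤ n) (A : Matrix (Fin n) (Fin n) ℝ)
    {c : ℝ} (hc : c ≠ 0) : esym n k (c • A) = c ^ k * esym n k A := by
  have hcp : ∀ t : ℝ, (c • A).charpoly.eval (c * t) = c ^ n * A.charpoly.eval t := by
    intro t
    rw [Matrix.eval_charpoly, Matrix.eval_charpoly]
    have : Matrix.scalar (Fin n) (c * t) - c • A = c • (Matrix.scalar (Fin n) t - A) := by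
      rw [smul_sub]; congr 1; ext i j; simp [Matrix.scalar_apply, Matrix.diagonal_apply]
    rw [this, Matrix.det_smul, Fintype.card_fin]
  have hpoly : (c • A).charpoly.comp (Polynomial.C c * Polynomial.X)
      = Polynomial.C (c ^ n) * A.charpoly := by
    apply Polynomial.funext
    intro t
    simpa using hcp t
  have h := congrArg (fun p => Polynomial.coeff p (n - k)) hpoly
  simp only [Polynomial.coeff_C_mul, Polynomial.comp_C_mul_X_coeff] at h
  rw [esym, esym]
  have h2 : c ^ n = c ^ k * c ^ (n - k) := by rw [← pow_add]; congr 1; omega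
  rw [h2] at h
  have h3 : (c • A).charpoly.coeff (n - k) = c ^ k * A.charpoly.coeff (n - k) := by
    have hne : c ^ (n - k) ≠ 0 := pow_ne_zero _ hc
    apply mul_right_cancel₀ hne
    linarith
  rw [h3]
  ring

theorem esym_pos_of_posSemidef {n k : ℕ} (hk : k + 1 ≤ n) {A : Matrix (Fin n) (Fin n) ℝ}
    (hA : A.PosSemidef) (x : En n)
    (hx : ∀ ξ : En n, ⟪ξ, x⟫ = 0 → ξ ≠ 0 → 0 < dotProduct ξ.ofLp (A.mulVec ξ.ofLp)) :
    0 < esym n k A := by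
  have hH := hA.isHermitian
  have hval : ∀ i, dotProduct (hH.eigenvectorBasis i).ofLp (A.mulVec (hH.eigenvectorBasis i).ofLp)
      = hH.eigenvalues i := by
    intro i
    simpa using (hH.eigenvalues_eq i).symm
  have hzero : ∀ i j, hH.eigenvalues i = 0 → hH.eigenvalues j = 0 → i = j := by
    intro i j hi hj
    by_contra hij
    set vi := hH.eigenvectorBasis i with hvi
    set vj := hH.eigenvectorBasis j with hvj
    have hAi : A.mulVec vi.ofLp = 0 := by
      rw [hvi, hH.mulVec_eigenvectorBasis, hi, zero_smul]
    have hAj : A.mulVec vj.ofLp = 0 := by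
      rw [hvj, hH.mulVec_eigenvectorBasis, hj, zero_smul]
    have hker : ∀ a b : ℝ, ⟪a • vi + b • vj, x⟫ = 0 → a • vi + b • vj = 0 := by
      intro a b hab
      by_contra hne
      have h := hx _ hab hne
      have : A.mulVec (a • vi + b • vj).ofLp = 0 := by
        simp [Matrix.mulVec_add, Matrix.mulVec_smul, hAi, hAj]
      rw [this] at h
      simp at h
    have hort : ⟪vi, vj⟫ = 0 := hH.eigenvectorBasis.orthonormal.2 hij
    have hni : ⟪vi, vi⟫ = 1 := by
      rw [real_inner_self_eq_norm_sq, hH.eigenvectorBasis.orthonormal.1 i]; norm_num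
    have hnj : ⟪vj, vj⟫ = 1 := by
      rw [real_inner_self_eq_norm_sq, hH.eigenvectorBasis.orthonormal.1 j]; norm_num
    have hcoef : ∀ a b : ℝ, a • vi + b • vj = 0 → a = 0 ∧ b = 0 := by
      intro a b hab
      have h1 := congrArg (fun z => ⟪z, vi⟫) hab
      have h2 := congrArg (fun z => ⟪z, vj⟫) hab
      simp only [inner_add_left, real_inner_smul_left, hort, real_inner_comm vi vj, hni, hnj,
        inner_zero_left, mul_one, mul_zero, add_zero, zero_add] at h1 h2
      exact ⟨h1, h2⟩
    have h0 := hcoef _ _ (hker ⟪vj, x⟫ (-⟪vi, x⟫) (by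
      simp only [inner_add_left, real_inner_smul_left]; ring))
    have h1 := hcoef _ _ (hker 1 0 (by
      simp only [inner_add_left, real_inner_smul_left]
      rw [neg_eq_zero.mp h0.2]; ring))
    exact one_ne_zero h1.1
  rw [esym_eq_coeff_prod (by omega) hH, Finset.prod_X_add_C_coeff _ _ (by simp)]
  have hcard : (Finset.univ : Finset (Fin n)).card - (n - k) = k := by
    rw [Finset.card_univ, Fintype.card_fin]; omega
  rw [hcard]
  obtain ⟨s, hs, hspos⟩ : ∃ s : Finset (Fin n), n - 1 ≤ s.card ∧
      ∀ i ∈ s, 0 < hH.eigenvalues i := by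
    by_cases h : ∃ i, hH.eigenvalues i = 0
    · obtain ⟨i, hi⟩ := h
      refine ⟨Finset.univ.erase i, by simp, fun j hj => ?_⟩
      exact lt_of_le_of_ne (hA.eigenvalues_nonneg j) fun h =>
        Finset.ne_of_mem_erase hj (hzero j i h.symm hi)
    · push Not at h
      exact ⟨Finset.univ, by simp, fun j _ =>
        lt_of_le_of_ne (hA.eigenvalues_nonneg j) (h j).symm⟩
  obtain ⟨t, hts, htc⟩ := Finset.exists_subset_card_eq (show k ≤ s.card by omega)
  refine Finset.sum_pos' (fun r _ => Finset.prod_nonneg fun i _ => hA.eigenvalues_nonneg i)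
    ⟨t, ?_, Finset.prod_pos fun i hi => hspos i (hts hi)⟩
  simp [Finset.mem_powersetCard, htc]

theorem hessMat_apply {n : ℕ} (w : En n → ℝ) (y : En n) (i j : Fin n) :
    hessMat w y i j
      = fderiv ℝ (fderiv ℝ w) y (EuclideanSpace.single i 1) (EuclideanSpace.single j 1) := by
  simp [hessMat, iteratedFDeriv_two_apply]

theorem sum_smul_single {n : ℕ} (ξ : En n) :
    ∑ i, ξ i • EuclideanSpace.single i (1 : ℝ) = ξ := by
  simpa using (EuclideanSpace.basisFun (Fin n) ℝ).sum_repr ξ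

theorem quadForm_hessMat {n : ℕ} (w : En n → ℝ) (y ξ : En n) :
    quadForm (hessMat w y) ξ = fderiv ℝ (fderiv ℝ w) y ξ ξ := by
  conv_rhs => rw [← sum_smul_single ξ]
  simp only [map_sum, map_smul, _root_.sum_apply, _root_.smul_apply,
    smul_eq_mul, quadForm, hessMat_apply, Finset.mul_sum]
  rw [Finset.sum_comm]
  exact Finset.sum_congr rfl fun i _ => Finset.sum_congr rfl fun j _ => by ring

theorem dotProduct_mulVec_eq_quadForm {n : ℕ} (A : Matrix (Fin n) (Fin n) ℝ) (ξ : En n) :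
    dotProduct ξ.ofLp (A.mulVec ξ.ofLp) = quadForm A ξ := by
  simp only [dotProduct, Matrix.mulVec, quadForm, Finset.mul_sum]
  exact Finset.sum_congr rfl fun i _ => Finset.sum_congr rfl fun j _ => by ring

theorem isHermitian_hessMat {n : ℕ} {w : En n → ℝ} {y : En n} (hw : ContDiffAt ℝ 2 w y) :
    (hessMat w y).IsHermitian := by
  have h := hw.isSymmSndFDerivAt (by simp)
  ext i j
  simp only [Matrix.conjTranspose_apply, star_trivial, hessMat_apply]
  exact h.eq _ _

theorem posSemidef_of_quadForm_nonneg {n : ℕ} {A : Matrix (Fin n) (Fin n) ℝ}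
    (hA : A.IsHermitian) (h : ∀ ξ : En n, 0 ≤ quadForm A ξ) : A.PosSemidef := by
  refine Matrix.posSemidef_iff_dotProduct_mulVec.mpr ⟨hA, fun x => ?_⟩
  have := dotProduct_mulVec_eq_quadForm A (WithLp.toLp 2 x)
  simp only [star_trivial]
  rw [show dotProduct x (A.mulVec x) = _ from this]
  exact h _

theorem eventually_differentiableAt_of_contDiffAt_two {n : ℕ} {w : En n → ℝ} {y : En n}
    (hw : ContDiffAt ℝ 2 w y) : ∀ᶠ z in 𝓝 y, DifferentiableAt ℝ w z :=
  (hw.eventually (by simp)).mono fun _ h => h.differentiableAt (by norm_num)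

theorem differentiableAt_fderiv_of_contDiffAt_two {n : ℕ} {w : En n → ℝ} {y : En n}
    (hw : ContDiffAt ℝ 2 w y) : DifferentiableAt ℝ (fderiv ℝ w) y :=
  (hw.fderiv_right (m := 1) (by norm_num)).differentiableAt (by norm_num)

theorem hessMat_sub {n : ℕ} {v w : En n → ℝ} {y : En n} (hv : ContDiffAt ℝ 2 v y)
    (hw : ContDiffAt ℝ 2 w y) :
    hessMat (fun z => v z - w z) y = hessMat v y - hessMat w y := by
  have h : fderiv ℝ (fun z => v z - w z) =ᶠ[𝓝 y] fun z => fderiv ℝ v z - fderiv ℝ w z := by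
    filter_upwards [eventually_differentiableAt_of_contDiffAt_two hv,
      eventually_differentiableAt_of_contDiffAt_two hw] with z h1 h2
    exact fderiv_fun_sub h1 h2
  ext i j
  rw [Matrix.sub_apply, hessMat_apply, hessMat_apply, hessMat_apply, h.fderiv_eq,
    fderiv_fun_sub (differentiableAt_fderiv_of_contDiffAt_two hv)
      (differentiableAt_fderiv_of_contDiffAt_two hw)]
  rfl

theorem hessMat_const_mul {n : ℕ} (c : ℝ) (w : En n → ℝ) (y : En n) :
    hessMat (fun z => c * w z) y = c • hessMat w y := by
  have h : fderiv ℝ (fun z => c * w z) = fun z => c • fderiv ℝ w z := by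
    exact fderiv_const_smul_field (f := w) c
  ext i j
  rw [Matrix.smul_apply, hessMat_apply, hessMat_apply, h]
  have h2 : fderiv ℝ (fun z => c • fderiv ℝ w z) y = c • fderiv ℝ (fderiv ℝ w) y :=
    congrFun (fderiv_const_smul_field (f := fderiv ℝ w) c) y
  rw [h2]
  rfl

theorem hessMat_comp_smul {n : ℕ} (c : ℝ) (w : En n → ℝ) (y : En n) :
    hessMat (fun z => w (c • z)) y = c ^ 2 • hessMat w (c • y) := by
  have h : fderiv ℝ (fun z => w (c • z)) = fun z => c • fderiv ℝ w (c • z) := by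
    ext1 z
    exact fderiv_comp_smul c
  ext i j
  rw [Matrix.smul_apply, hessMat_apply, hessMat_apply, h]
  have h2 : fderiv ℝ (fun z => c • fderiv ℝ w (c • z)) y
      = c • c • fderiv ℝ (fderiv ℝ w) (c • y) := by
    rw [← fderiv_comp_smul]
    exact congrFun (fderiv_const_smul_field (f := fun z => fderiv ℝ w (c • z)) c) y
  rw [h2, smul_smul, ← pow_two]
  rfl

theorem hasDerivAt_comp_line {n : ℕ} {w : En n → ℝ} {y ξ : En n} {s : ℝ}
    (h : DifferentiableAt ℝ w (y + s • ξ)) :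
    HasDerivAt (fun r : ℝ => w (y + r • ξ)) (fderiv ℝ w (y + s • ξ) ξ) s := by
  have h1 : HasDerivAt (fun r : ℝ => y + r • ξ) ξ s := by
    simpa using ((hasDerivAt_id s).smul_const ξ).const_add y
  exact h.hasFDerivAt.comp_hasDerivAt s h1

theorem tendsto_line {n : ℕ} (y ξ : En n) : Tendsto (fun r : ℝ => y + r • ξ) (𝓝 0) (𝓝 y) := by
  have : Continuous fun r : ℝ => y + r • ξ := by fun_prop
  simpa using this.tendsto 0

theorem deriv_comp_line_eventuallyEq {n : ℕ} {w : En n → ℝ} {y : En n} (hw : ContDiffAt ℝ 2 w y)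
    (ξ : En n) : deriv (fun r : ℝ => w (y + r • ξ)) =ᶠ[𝓝 0] fun r => fderiv ℝ w (y + r • ξ) ξ := by
  filter_upwards [(tendsto_line y ξ).eventually (eventually_differentiableAt_of_contDiffAt_two hw)]
    with s hs
  exact (hasDerivAt_comp_line hs).deriv

theorem deriv_deriv_comp_line {n : ℕ} {w : En n → ℝ} {y : En n} (hw : ContDiffAt ℝ 2 w y)
    (ξ : En n) : deriv (deriv fun r : ℝ => w (y + r • ξ)) 0 = fderiv ℝ (fderiv ℝ w) y ξ ξ := by
  rw [(deriv_comp_line_eventuallyEq hw ξ).deriv_eq]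
  have h1 : HasDerivAt (fun r : ℝ => y + r • ξ) ξ 0 := by
    simpa using ((hasDerivAt_id (0 : ℝ)).smul_const ξ).const_add y
  have h2 : HasFDerivAt (fderiv ℝ w) (fderiv ℝ (fderiv ℝ w) y) (y + (0 : ℝ) • ξ) := by
    simpa using (differentiableAt_fderiv_of_contDiffAt_two hw).hasFDerivAt
  have h3 : HasDerivAt (fun r : ℝ => fderiv ℝ w (y + r • ξ)) (fderiv ℝ (fderiv ℝ w) y ξ) 0 :=
    h2.comp_hasDerivAt (0 : ℝ) h1
  have h4 := ((ContinuousLinearMap.apply ℝ ℝ ξ).hasFDerivAt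
    (x := fderiv ℝ w (y + (0 : ℝ) • ξ))).comp_hasDerivAt (0 : ℝ) h3
  exact h4.deriv

theorem fderiv_fderiv_nonneg_of_isLocalMin {n : ℕ} {w : En n → ℝ} {y : En n}
    (hw : ContDiffAt ℝ 2 w y) (hmin : IsLocalMin w y) (ξ : En n) :
    0 ≤ fderiv ℝ (fderiv ℝ w) y ξ ξ := by
  rw [← deriv_deriv_comp_line hw ξ]
  by_contra! hneg
  set φ : ℝ → ℝ := fun r => w (y + r • ξ) with hφ
  have hmin' : IsLocalMin φ 0 := by
    have := (tendsto_line y ξ).eventually hmin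
    simpa [IsLocalMin, IsMinFilter, hφ] using this
  have hcont : ContinuousAt φ 0 := by
    have h1 : ContinuousAt w (y + (0 : ℝ) • ξ) := by simpa using hw.continuousAt
    exact ContinuousAt.comp (f := fun r : ℝ => y + r • ξ) h1 (by fun_prop)
  have hmax := isLocalMax_of_deriv_deriv_neg hneg hmin'.deriv_eq_zero hcont
  have hconst : φ =ᶠ[𝓝 0] fun _ => φ 0 := by
    filter_upwards [hmin', hmax] with s h1 h2
    exact le_antisymm h2 h1
  have : deriv φ =ᶠ[𝓝 0] fun _ => 0 := by
    simpa using hconst.deriv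
  rw [this.deriv_eq] at hneg
  simp at hneg

theorem posSemidef_hessMat_of_isLocalMin {n : ℕ} {w : En n → ℝ} {y : En n}
    (hw : ContDiffAt ℝ 2 w y) (hmin : IsLocalMin w y) : (hessMat w y).PosSemidef :=
  posSemidef_of_quadForm_nonneg (isHermitian_hessMat hw) fun ξ => by
    rw [quadForm_hessMat]
    exact fderiv_fderiv_nonneg_of_isLocalMin hw hmin ξ

theorem inner_le_suppFun {n : ℕ} {Ω : Set (En n)} (hΩ : IsCompact Ω) (x : En n) {y : En n}
    (hy : y ∈ Ω) : ⟪x, y⟫ ≤ suppFun Ω x :=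
  le_csSup (hΩ.image (by fun_prop)).bddAbove (mem_image_of_mem _ hy)

theorem exists_inner_eq_suppFun {n : ℕ} {Ω : Set (En n)} (hΩ : IsCompact Ω) (hne : Ω.Nonempty)
    (x : En n) : ∃ y ∈ Ω, ⟪x, y⟫ = suppFun Ω x :=
  (hΩ.image (f := fun y => ⟪x, y⟫) (by fun_prop)).sSup_mem (hne.image _)

theorem IsConvexBodyO.nonempty {n : ℕ} {Ω : Set (En n)} (h : IsConvexBodyO n Ω) : Ω.Nonempty :=
  ⟨0, interior_subset h.zeroInt⟩

open scoped Pointwise in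
theorem suppFun_smul_of_nonneg {n : ℕ} (Ω : Set (En n)) {c : ℝ} (hc : 0 ≤ c) (x : En n) :
    suppFun Ω (c • x) = c * suppFun Ω x := by
  have : (fun y => ⟪c • x, y⟫) '' Ω = c • ((fun y => ⟪x, y⟫) '' Ω) := by
    ext r
    simp [Set.mem_smul_set, real_inner_smul_left]
  rw [suppFun, this, Real.sSup_smul_of_nonneg hc]
  rfl

theorem suppFun_add_le {n : ℕ} {Ω : Set (En n)} (h : IsConvexBodyO n Ω) (x z : En n) :
    suppFun Ω (x + z) ≤ suppFun Ω x + suppFun Ω z := by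
  obtain ⟨y, hy, hxy⟩ := exists_inner_eq_suppFun h.comp h.nonempty (x + z)
  rw [← hxy, inner_add_left]
  exact add_le_add (inner_le_suppFun h.comp x hy) (inner_le_suppFun h.comp z hy)

theorem suppFun_eq_norm_mul {n : ℕ} (Ω : Set (En n)) {x : En n} (hx : x ≠ 0) :
    suppFun Ω x = ‖x‖ * suppFun Ω (‖x‖⁻¹ • x) := by
  rw [← suppFun_smul_of_nonneg Ω (norm_nonneg x), smul_inv_smul₀ (norm_ne_zero_iff.mpr hx)]

theorem suppFun_pos {n : ℕ} {Ω : Set (En n)} (h : IsConvexBodyO n Ω) {x : En n} (hx : x ≠ 0) :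
    0 < suppFun Ω x := by
  obtain ⟨s, hs, hs2⟩ : ∃ s : ℝ, 0 < s ∧ s • x ∈ Ω := by
    have h1 : ∀ᶠ s : ℝ in 𝓝 0, s • x ∈ Ω := by
      have : Tendsto (fun s : ℝ => s • x) (𝓝 0) (𝓝 0) := by
        simpa using (show Continuous fun s : ℝ => s • x by fun_prop).tendsto 0
      exact this.eventually (mem_interior_iff_mem_nhds.mp h.zeroInt)
    have h2 : ∀ᶠ s : ℝ in 𝓝[>] 0, s • x ∈ Ω := h1.filter_mono nhdsWithin_le_nhds
    exact ((eventually_mem_nhdsWithin (a := (0 : ℝ)) (s := Ioi 0)).and h2).exists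
  have h3 := inner_le_suppFun h.comp x hs2
  rw [real_inner_smul_right, real_inner_self_eq_norm_sq] at h3
  have : 0 < s * ‖x‖ ^ 2 := by positivity
  linarith

theorem mem_of_forall_inner_le_suppFun {n : ℕ} {Ω : Set (En n)} (h : IsConvexBodyO n Ω)
    {w : En n} (hw : ∀ z : En n, ‖z‖ = 1 → ⟪z, w⟫ ≤ suppFun Ω z) : w ∈ Ω := by
  by_contra hwΩ
  obtain ⟨φ, c, h1, h2⟩ := geometric_hahn_banach_closed_point h.conv h.comp.isClosed hwΩ
  set g := (InnerProductSpace.toDual ℝ (En n)).symm φ with hg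
  have hφ : ∀ y, φ y = ⟪g, y⟫ := fun y => by simp [hg]
  have hc : 0 < c := by simpa using h1 0 (interior_subset h.zeroInt)
  have hg0 : g ≠ 0 := by
    intro h0
    rw [hφ, h0, inner_zero_left] at h2
    linarith
  have hn : ‖‖g‖⁻¹ • g‖ = 1 := by
    rw [norm_smul, norm_inv, norm_norm, inv_mul_cancel₀ (norm_ne_zero_iff.mpr hg0)]
  obtain ⟨y, hy, hgy⟩ := exists_inner_eq_suppFun h.comp h.nonempty g
  have h3 := hw _ hn
  rw [real_inner_smul_left, suppFun_smul_of_nonneg Ω (by positivity), ← hgy] at h3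
  have h4 := le_of_mul_le_mul_left h3 (inv_pos.mpr (norm_pos_iff.mpr hg0))
  rw [← hφ, ← hφ] at h4
  linarith [h1 y hy]

theorem smul_mem_of_mul_suppFun_le {n : ℕ} {Ω₁ Ω₂ : Set (En n)} (h₁ : IsConvexBodyO n Ω₁)
    (h₂ : IsConvexBodyO n Ω₂) {c : ℝ} (hc : 0 ≤ c)
    (h : ∀ x : En n, ‖x‖ = 1 → c * suppFun Ω₁ x ≤ suppFun Ω₂ x) {y : En n} (hy : y ∈ Ω₁) :
    c • y ∈ Ω₂ :=
  mem_of_forall_inner_le_suppFun h₂ fun z hz => by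
    rw [real_inner_smul_right]
    exact (mul_le_mul_of_nonneg_left (inner_le_suppFun h₁.comp z hy) hc).trans (h z hz)

theorem IsSmoothStrictlyConvexBody.contDiffAt {n : ℕ} {Ω : Set (En n)}
    (h : IsSmoothStrictlyConvexBody n Ω) {x : En n} (hx : x ≠ 0) :
    ContDiffAt ℝ 2 (suppFun Ω) x :=
  ((h.suppSmooth x hx).contDiffAt (isOpen_compl_singleton.mem_nhds hx)).of_le
    (by exact WithTop.coe_le_coe.mpr le_top)

theorem IsSmoothStrictlyConvexBody.differentiableAt {n : ℕ} {Ω : Set (En n)}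
    (h : IsSmoothStrictlyConvexBody n Ω) {x : En n} (hx : x ≠ 0) :
    DifferentiableAt ℝ (suppFun Ω) x :=
  (h.contDiffAt hx).differentiableAt (by norm_num)

theorem ne_zero_of_norm_eq_one {n : ℕ} {x : En n} (hx : ‖x‖ = 1) : x ≠ 0 := by
  rintro rfl
  simp at hx

theorem hessMat_inner {n : ℕ} (y x : En n) : hessMat (fun z => ⟪z, y⟫) x = 0 := by
  have h : fderiv ℝ (fun z : En n => ⟪z, y⟫) = fun _ => innerSL ℝ y := by
    ext1 z
    have : (fun z : En n => ⟪z, y⟫) = innerSL ℝ y := by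
      ext z
      simp [real_inner_comm]
    rw [this]
    exact (innerSL ℝ y).fderiv
  ext i j
  rw [hessMat_apply, h]
  simp

theorem gradient_suppFun_eq {n : ℕ} {Ω : Set (En n)} (h : IsSmoothStrictlyConvexBody n Ω)
    {x y : En n} (hx : x ≠ 0) (hy : y ∈ Ω) (hxy : ⟪x, y⟫ = suppFun Ω x) :
    gradient (suppFun Ω) x = y := by
  have hmin : IsLocalMin (fun z => suppFun Ω z - ⟪z, y⟫) x := by
    refine Eventually.of_forall fun z => ?_
    simp only [hxy, sub_self]
    exact sub_nonneg.mpr (inner_le_suppFun h.body.comp z hy)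
  have h1 : HasFDerivAt (fun z => suppFun Ω z - ⟪z, y⟫)
      (fderiv ℝ (suppFun Ω) x - innerSL ℝ y) x := by
    refine (h.differentiableAt hx).hasFDerivAt.fun_sub ?_
    have : (fun z : En n => ⟪z, y⟫) = innerSL ℝ y := by
      ext z
      simp [real_inner_comm]
    rw [this]
    exact (innerSL ℝ y).hasFDerivAt
  have h2 := hmin.hasFDerivAt_eq_zero h1
  rw [sub_eq_zero] at h2
  rw [gradient, h2]
  exact (InnerProductSpace.toDual ℝ (En n)).symm_apply_apply y

theorem gradient_suppFun_mem {n : ℕ} {Ω : Set (En n)} (h : IsSmoothStrictlyConvexBody n Ω)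
    {x : En n} (hx : x ≠ 0) :
    gradient (suppFun Ω) x ∈ Ω ∧ ⟪x, gradient (suppFun Ω) x⟫ = suppFun Ω x := by
  obtain ⟨y, hy, hxy⟩ := exists_inner_eq_suppFun h.body.comp h.body.nonempty x
  rw [gradient_suppFun_eq h hx hy hxy]
  exact ⟨hy, hxy⟩

theorem posSemidef_hessMat_suppFun {n : ℕ} {Ω : Set (En n)} (h : IsSmoothStrictlyConvexBody n Ω)
    {x : En n} (hx : x ≠ 0) : (hessMat (suppFun Ω) x).PosSemidef := by
  obtain ⟨hy, hxy⟩ := gradient_suppFun_mem h hx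
  set y := gradient (suppFun Ω) x
  have hmin : IsLocalMin (fun z => suppFun Ω z - ⟪z, y⟫) x := by
    refine Eventually.of_forall fun z => ?_
    simp only [hxy, sub_self]
    exact sub_nonneg.mpr (inner_le_suppFun h.body.comp z hy)
  have hlin : ContDiffAt ℝ 2 (fun z : En n => ⟪z, y⟫) x := (contDiff_id.inner ℝ contDiff_const).contDiffAt
  have h2 := posSemidef_hessMat_of_isLocalMin ((h.contDiffAt hx).sub hlin) hmin
  rwa [hessMat_sub (h.contDiffAt hx) hlin, hessMat_inner, sub_zero] at h2

theorem gradient_suppFun_mem_frontier {n : ℕ} {Ω : Set (En n)}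
    (h : IsSmoothStrictlyConvexBody n Ω) {x : En n} (hx : x ≠ 0) :
    gradient (suppFun Ω) x ∈ frontier Ω := by
  obtain ⟨hy, hxy⟩ := gradient_suppFun_mem h hx
  set y := gradient (suppFun Ω) x
  rw [h.body.comp.isClosed.frontier_eq]
  refine ⟨hy, fun hint => ?_⟩
  have h1 : ∀ᶠ s : ℝ in 𝓝 0, y + s • x ∈ Ω :=
    (tendsto_line y x).eventually (mem_interior_iff_mem_nhds.mp hint)
  have h2 : ∀ᶠ s : ℝ in 𝓝[>] 0, y + s • x ∈ Ω := h1.filter_mono nhdsWithin_le_nhds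
  obtain ⟨s, hs, hs2⟩ :=
    ((eventually_mem_nhdsWithin (a := (0 : ℝ)) (s := Ioi 0)).and h2).exists
  have h3 := inner_le_suppFun h.body.comp x hs2
  rw [inner_add_right, hxy, real_inner_smul_right, real_inner_self_eq_norm_sq] at h3
  have hs0 : 0 < s := hs
  have : 0 < s * ‖x‖ ^ 2 := by
    have := norm_pos_iff.mpr hx
    positivity
  linarith

/-- A boundary point of a smooth strictly convex body has only one outer unit normal. -/
theorem eq_of_inner_gradient_suppFun_eq {n : ℕ} {Ω : Set (En n)}
    (h : IsSmoothStrictlyConvexBody n Ω) {x z : En n} (hx : ‖x‖ = 1) (hz : ‖z‖ = 1)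
    (hzy : ⟪z, gradient (suppFun Ω) x⟫ = suppFun Ω z) : z = x := by
  have hx0 := ne_zero_of_norm_eq_one hx
  obtain ⟨hy, hxy⟩ := gradient_suppFun_mem h hx0
  set y := gradient (suppFun Ω) x
  set G : En n → ℝ := fun v => suppFun Ω v - ⟪v, y⟫ with hG
  have hlin : ContDiffAt ℝ 2 (fun z : En n => ⟪z, y⟫) x := (contDiff_id.inner ℝ contDiff_const).contDiffAt
  have hGc : ContDiffAt ℝ 2 G x := (h.contDiffAt hx0).sub hlin
  have hG0 : ∀ v, 0 ≤ G v := fun v => sub_nonneg.mpr (inner_le_suppFun h.body.comp v hy)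
  set ξ := z - ⟪z, x⟫ • x with hξ
  have hort : ⟪ξ, x⟫ = 0 := by
    rw [hξ, inner_sub_left, real_inner_smul_left, real_inner_self_eq_norm_sq, hx]
    ring
  have hseg : ∀ᶠ s : ℝ in 𝓝[≥] 0, G (x + s • ξ) = 0 := by
    have hc : ∀ᶠ s : ℝ in 𝓝 0, 0 < 1 - s * ⟪z, x⟫ := by
      have : Tendsto (fun s : ℝ => 1 - s * ⟪z, x⟫) (𝓝 0) (𝓝 1) := by
        simpa using (show Continuous fun s : ℝ => 1 - s * ⟪z, x⟫ by fun_prop).tendsto 0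
      exact this.eventually (lt_mem_nhds one_pos)
    filter_upwards [hc.filter_mono nhdsWithin_le_nhds, eventually_mem_nhdsWithin] with s h1 h2
    have hs : (0 : ℝ) ≤ s := h2
    refine le_antisymm ?_ (hG0 _)
    have he : x + s • ξ = (1 - s * ⟪z, x⟫) • x + s • z := by
      rw [hξ]
      module
    simp only [hG]
    rw [he]
    have h3 := suppFun_add_le h.body ((1 - s * ⟪z, x⟫) • x) (s • z)
    rw [suppFun_smul_of_nonneg Ω h1.le, suppFun_smul_of_nonneg Ω hs] at h3
    rw [inner_add_left, real_inner_smul_left, real_inner_smul_left, hxy, hzy]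
    linarith
  have hD : deriv (deriv fun r : ℝ => G (x + r • ξ)) 0 = 0 := by
    by_contra hne
    set φ : ℝ → ℝ := fun r => G (x + r • ξ) with hφ
    have hd := (differentiableAt_of_deriv_ne_zero hne).hasDerivAt
    have hφ0 : φ 0 = 0 := hseg.self_of_nhdsWithin (by simp)
    have hd0 : deriv φ 0 = 0 := by
      have : IsLocalMin φ 0 := Eventually.of_forall fun r => by
        rw [hφ0]
        exact hG0 _
      exact this.deriv_eq_zero
    have hev : deriv φ =ᶠ[𝓝[>] 0] fun _ => (0 : ℝ) := by
      have h1 : ∀ᶠ s : ℝ in 𝓝[>] 0, φ s = 0 :=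
        hseg.filter_mono (nhdsWithin_mono _ Ioi_subset_Ici_self)
      obtain ⟨δ, hδ, hδ2⟩ := mem_nhdsGT_iff_exists_Ioo_subset.mp h1
      filter_upwards [Ioo_mem_nhdsGT hδ] with s hs
      have : φ =ᶠ[𝓝 s] fun _ => (0 : ℝ) := by
        filter_upwards [Ioo_mem_nhds hs.1 hs.2] with r hr
        exact hδ2 hr
      rw [this.deriv_eq]
      simp
    have h1 : HasDerivWithinAt (deriv φ) 0 (Ioi 0) 0 :=
      (hasDerivWithinAt_const (0 : ℝ) _ (0 : ℝ)).congr_of_eventuallyEq hev hd0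
    exact hne ((uniqueDiffWithinAt_Ioi (0 : ℝ)).eq_deriv _ hd.hasDerivWithinAt h1)
  rw [deriv_deriv_comp_line hGc, ← quadForm_hessMat,
    hessMat_sub (h.contDiffAt hx0) hlin, hessMat_inner, sub_zero] at hD
  have hξ0 : ξ = 0 := by
    by_contra hne
    exact (h.strictConv x hx ξ hort hne).ne' hD
  have hzx : z = ⟪z, x⟫ • x := sub_eq_zero.mp hξ0
  have habs : |⟪z, x⟫| = 1 := by
    have := congrArg norm hzx
    rw [norm_smul, hz, hx, mul_one, Real.norm_eq_abs] at this
    exact this.symm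
  rcases (abs_eq zero_le_one).mp habs with h1 | h1
  · rw [hzx, h1, one_smul]
  · exfalso
    rw [h1, neg_one_smul] at hzx
    have h2 := suppFun_pos h.body hx0
    have h3 := suppFun_pos h.body (ne_zero_of_norm_eq_one hz)
    rw [← hzy, hzx, inner_neg_left, hxy] at h3
    linarith

theorem continuousOn_suppFun {n : ℕ} {Ω : Set (En n)} (h : IsSmoothStrictlyConvexBody n Ω) :
    ContinuousOn (suppFun Ω) {(0 : En n)}ᶜ :=
  h.suppSmooth.continuousOn

theorem eventually_gradient_suppFun_add_mem {n : ℕ} {Ω : Set (En n)}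
    (h : IsSmoothStrictlyConvexBody n Ω) {x d : En n} (hx : ‖x‖ = 1) (hd : ⟪d, x⟫ < 0) :
    ∀ᶠ s : ℝ in 𝓝[>] 0, gradient (suppFun Ω) x + s • d ∈ Ω := by
  have hx0 := ne_zero_of_norm_eq_one hx
  obtain ⟨hy, hxy⟩ := gradient_suppFun_mem h hx0
  have huniq := fun z hz => eq_of_inner_gradient_suppFun_eq h (z := z) hx hz
  set y := gradient (suppFun Ω) x
  set K : Set (En n) := Metric.sphere 0 1 ∩ {z | 0 ≤ ⟪d, z⟫} with hK
  have hKc : IsCompact K :=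
    (isCompact_sphere 0 1).inter_right (isClosed_le continuous_const (by fun_prop))
  have hcont : ContinuousOn (fun z => suppFun Ω z - ⟪z, y⟫) K := by
    refine ContinuousOn.sub ((continuousOn_suppFun h).mono fun z hz => ?_) (by fun_prop)
    exact ne_zero_of_norm_eq_one (by simpa using hz.1)
  obtain ⟨c, hc, hcK⟩ := hKc.exists_forall_le' hcont (a := 0) fun z hz => by
    refine lt_of_le_of_ne (sub_nonneg.mpr (inner_le_suppFun h.body.comp z hy)) fun heq => ?_
    have hzx := huniq z (by simpa using hz.1) (by linarith)
    have h2 : 0 ≤ ⟪d, z⟫ := hz.2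
    rw [hzx] at h2
    linarith
  have hsm : ∀ᶠ s : ℝ in 𝓝 0, s * ‖d‖ < c := by
    have : Tendsto (fun s : ℝ => s * ‖d‖) (𝓝 0) (𝓝 0) := by
      simpa using (show Continuous fun s : ℝ => s * ‖d‖ by fun_prop).tendsto 0
    exact this.eventually (gt_mem_nhds hc)
  filter_upwards [hsm.filter_mono nhdsWithin_le_nhds, eventually_mem_nhdsWithin] with s h1 h2
  have hs : (0 : ℝ) < s := h2
  refine mem_of_forall_inner_le_suppFun h.body fun z hz => ?_
  rw [inner_add_right, real_inner_smul_right]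
  by_cases hdz : 0 ≤ ⟪d, z⟫
  · have h3 := hcK z ⟨by simpa using hz, hdz⟩
    have h4 : ⟪z, d⟫ ≤ ‖d‖ := by simpa [hz] using real_inner_le_norm z d
    nlinarith
  · have h3 := inner_le_suppFun h.body.comp z hy
    rw [real_inner_comm] at hdz
    nlinarith

theorem norm_le_of_forall_inner_le {n : ℕ} {x g₁ g₂ : En n} (hx : ‖x‖ = 1)
    (h : ∀ d : En n, ⟪d, x⟫ < 0 → ⟪g₂, d⟫ ≤ ⟪g₁, d⟫ ∧ ⟪g₁, d⟫ ≤ 0) : ‖g₁‖ ≤ ‖g₂‖ := by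
  have hxx : ⟪x, x⟫ = 1 := by rw [real_inner_self_eq_norm_sq, hx]; norm_num
  have hlim : ∀ ε > 0, ⟪g₁, g₁⟫ - ⟪g₁, x⟫ ^ 2 - ε * ⟪g₁, x⟫ ≤ 0 := by
    intro ε hε
    have h1 := (h (g₁ - (⟪g₁, x⟫ + ε) • x) (by
      rw [inner_sub_left, real_inner_smul_left, hxx]; linarith)).2
    rw [inner_sub_right, real_inner_smul_right] at h1
    nlinarith
  have h2 : ⟪g₁, g₁⟫ - ⟪g₁, x⟫ ^ 2 ≤ 0 := by
    have ht : Tendsto (fun ε : ℝ => ⟪g₁, g₁⟫ - ⟪g₁, x⟫ ^ 2 - ε * ⟪g₁, x⟫) (𝓝[>] 0)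
        (𝓝 (⟪g₁, g₁⟫ - ⟪g₁, x⟫ ^ 2)) := by
      have : Continuous fun ε : ℝ => ⟪g₁, g₁⟫ - ⟪g₁, x⟫ ^ 2 - ε * ⟪g₁, x⟫ := by fun_prop
      simpa using (this.tendsto 0).mono_left nhdsWithin_le_nhds
    exact le_of_tendsto ht (eventually_mem_nhdsWithin.mono fun ε hε => hlim ε hε)
  have h3 := h (-x) (by rw [inner_neg_left, hxx]; norm_num)
  rw [inner_neg_right, inner_neg_right] at h3
  have h4 : ⟪g₂, x⟫ ≤ ‖g₂‖ := by simpa [hx] using real_inner_le_norm g₂ x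
  rw [real_inner_self_eq_norm_sq] at h2
  have h5 : ‖g₁‖ ≤ ⟪g₁, x⟫ := abs_le_of_sq_le_sq' (by linarith) (by linarith) |>.2
  linarith

theorem hessMat_zero {n : ℕ} (y : En n) : hessMat (fun _ => (0 : ℝ)) y = 0 := by
  simpa using hessMat_const_mul 0 (fun _ => (0 : ℝ)) y

theorem posSemidef_hessMat_sub {n : ℕ} {v w : En n → ℝ} {y : En n} (hv : ContDiffAt ℝ 2 v y)
    (hw : ContDiffAt ℝ 2 w y) (hmin : IsLocalMin (fun z => v z - w z) y) :
    (hessMat v y - hessMat w y).PosSemidef := by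
  rw [← hessMat_sub hv hw]
  exact posSemidef_hessMat_of_isLocalMin (hv.sub hw) hmin

theorem esym_hessMat_le_of_isLocalMin {n k : ℕ} (hk : k + 1 ≤ n) {v w : En n → ℝ} {y : En n}
    (hv : ContDiffAt ℝ 2 v y) (hw : ContDiffAt ℝ 2 w y)
    (hmin : IsLocalMin (fun z => v z - w z) y) (hpos : ∀ j ≤ k, 0 ≤ esym n j (hessMat w y)) :
    esym n k (hessMat w y) ≤ esym n k (hessMat v y) := by
  have h := esym_le_esym_add_posSemidef hk (isHermitian_hessMat hw) hpos
    (posSemidef_hessMat_sub hv hw hmin) k le_rfl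
  rwa [add_sub_cancel] at h

theorem IsAdmissibleSolution.contDiffAt {n k : ℕ} {Ω : Set (En n)} {u : En n → ℝ}
    (h : IsAdmissibleSolution n k Ω u) (y : En n) : ContDiffAt ℝ 2 u y :=
  (h.smooth.of_le (by exact WithTop.coe_le_coe.mpr le_top)).contDiffAt

theorem IsAdmissibleSolution.esym_nonneg {n k : ℕ} {Ω : Set (En n)} {u : En n → ℝ}
    (h : IsAdmissibleSolution n k Ω u) {y : En n} (hy : y ∈ interior Ω) :
    ∀ j ≤ k, 0 ≤ esym n j (hessMat u y) := by
  intro j hj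
  rcases Nat.eq_zero_or_pos j with rfl | hj0
  · rw [esym_zero]
    exact zero_le_one
  · exact h.kconv y hy j hj0 hj

theorem IsConvexBodyO.mem_frontier_of_notMem_interior {n : ℕ} {Ω : Set (En n)}
    (h : IsConvexBodyO n Ω) {y : En n} (hy : y ∈ Ω) (hint : y ∉ interior Ω) : y ∈ frontier Ω := by
  rw [h.comp.isClosed.frontier_eq]
  exact ⟨hy, hint⟩

theorem IsAdmissibleSolution.nonpos {n k : ℕ} (hk1 : 1 ≤ k) (hk : k + 1 ≤ n) {Ω : Set (En n)}
    {u : En n → ℝ} (hΩ : IsConvexBodyO n Ω) (h : IsAdmissibleSolution n k Ω u) {y : En n}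
    (hy : y ∈ Ω) : u y ≤ 0 := by
  obtain ⟨z, hz, hmax⟩ := hΩ.comp.exists_isMaxOn hΩ.nonempty h.smooth.continuous.continuousOn
  refine (hmax hy).trans ?_
  by_contra! hpos
  have hint : z ∈ interior Ω := by
    by_contra hint
    exact hpos.ne' (h.bd z (hΩ.mem_frontier_of_notMem_interior hz hint))
  have hmin : IsLocalMin (fun z => (fun _ => (0 : ℝ)) z - u z) z := by
    filter_upwards [mem_interior_iff_mem_nhds.mp hint] with v hv
    have : u v ≤ u z := hmax hv
    simpa using this
  have h1 := esym_hessMat_le_of_isLocalMin hk contDiffAt_const (h.contDiffAt z) hmin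
    (h.esym_nonneg hint)
  rw [h.eqn z hint, hessMat_zero, esym_zero_matrix hk1 (by omega)] at h1
  linarith

theorem smul_mem_interior_of_forall_smul_mem {n : ℕ} {Ω₁ Ω₂ : Set (En n)} {c : ℝ} (hc : 0 < c)
    (hsub : ∀ y ∈ Ω₁, c • y ∈ Ω₂) {y : En n} (hy : y ∈ interior Ω₁) : c • y ∈ interior Ω₂ := by
  refine mem_interior.mpr ⟨(fun z => c • z) '' interior Ω₁, ?_,
    isOpenMap_smul₀ hc.ne' _ isOpen_interior, mem_image_of_mem _ hy⟩
  rintro _ ⟨z, hz, rfl⟩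
  exact hsub z (interior_subset hz)

theorem IsAdmissibleSolution.le_of_forall_smul_mem {n k : ℕ} (hk1 : 1 ≤ k) (hk : k + 1 ≤ n)
    {Ω₁ Ω₂ : Set (En n)} {u₁ u₂ : En n → ℝ} (hΩ₁ : IsConvexBodyO n Ω₁) (hΩ₂ : IsConvexBodyO n Ω₂)
    (h₁ : IsAdmissibleSolution n k Ω₁ u₁) (h₂ : IsAdmissibleSolution n k Ω₂ u₂) {c : ℝ}
    (hc : 0 < c) (hsub : ∀ y ∈ Ω₁, c • y ∈ Ω₂) {y : En n} (hy : y ∈ Ω₁) :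
    u₂ (c • y) ≤ c ^ 2 * u₁ y := by
  have key : ∀ ε > 0, 0 ≤ u₁ y - (1 + ε) * (c⁻¹ ^ 2 * u₂ (c • y)) := by
    intro ε hε
    set v : En n → ℝ := fun z => (1 + ε) * (c⁻¹ ^ 2 * u₂ (c • z)) with hv
    have hvc : ContDiff ℝ 2 v := by
      have : ContDiff ℝ 2 u₂ := h₂.smooth.of_le (by exact WithTop.coe_le_coe.mpr le_top)
      exact contDiff_const.mul (contDiff_const.mul (this.comp (contDiff_const_smul c)))
    have hvH : ∀ z, hessMat v z = (1 + ε) • hessMat u₂ (c • z) := by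
      intro z
      rw [hv, hessMat_const_mul, hessMat_const_mul, hessMat_comp_smul, smul_smul (c⁻¹ ^ 2),
        ← mul_pow, inv_mul_cancel₀ hc.ne', one_pow, one_smul]
    obtain ⟨z, hz, hmin⟩ := hΩ₁.comp.exists_isMinOn hΩ₁.nonempty
      (h₁.smooth.continuous.sub hvc.continuous).continuousOn
    refine le_trans ?_ (hmin hy)
    by_cases hint : z ∈ interior Ω₁
    · exfalso
      have hint₂ := smul_mem_interior_of_forall_smul_mem hc hsub hint
      have hloc : IsLocalMin (fun z => u₁ z - v z) z := by
        filter_upwards [mem_interior_iff_mem_nhds.mp hint] with r hr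
        exact hmin hr
      have h3 := esym_hessMat_le_of_isLocalMin hk (h₁.contDiffAt z) hvc.contDiffAt hloc
        (fun j hj => by
          rw [hvH, esym_smul (by omega) _ (by positivity)]
          exact mul_nonneg (by positivity) (h₂.esym_nonneg hint₂ j hj))
      rw [hvH, esym_smul (by omega) _ (by positivity), h₁.eqn z hint, h₂.eqn _ hint₂, mul_one]
        at h3
      have := one_lt_pow₀ (show 1 < 1 + ε by linarith) (n := k) (by omega)
      linarith
    · have h3 := h₁.bd z (hΩ₁.mem_frontier_of_notMem_interior hz hint)
      have h4 := h₂.nonpos hk1 hk hΩ₂ (hsub z hz)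
      change 0 ≤ u₁ z - v z
      simp only [hv, h3]
      have : 0 ≤ (1 + ε) * (c⁻¹ ^ 2 * -u₂ (c • z)) := by
        have : 0 ≤ -u₂ (c • z) := by linarith
        positivity
      linarith
  have hlim : 0 ≤ u₁ y - c⁻¹ ^ 2 * u₂ (c • y) := by
    have ht : Tendsto (fun ε : ℝ => u₁ y - (1 + ε) * (c⁻¹ ^ 2 * u₂ (c • y))) (𝓝[>] 0)
        (𝓝 (u₁ y - c⁻¹ ^ 2 * u₂ (c • y))) := by
      have : Continuous fun ε : ℝ => u₁ y - (1 + ε) * (c⁻¹ ^ 2 * u₂ (c • y)) := by fun_prop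
      simpa using (this.tendsto 0).mono_left nhdsWithin_le_nhds
    exact ge_of_tendsto ht (eventually_mem_nhdsWithin.mono fun ε hε => key ε hε)
  have h5 := mul_nonneg (sq_nonneg c) hlim
  have h6 : c ^ 2 * c⁻¹ ^ 2 = 1 := by rw [← mul_pow, mul_inv_cancel₀ hc.ne', one_pow]
  have h7 : c ^ 2 * (u₁ y - c⁻¹ ^ 2 * u₂ (c • y))
      = c ^ 2 * u₁ y - (c ^ 2 * c⁻¹ ^ 2) * u₂ (c • y) := by ring
  rw [h7, h6] at h5
  linarith

theorem HasDerivAt.nonpos_of_eventually_le {φ : ℝ → ℝ} {a t : ℝ} (h : HasDerivAt φ a t)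
    (hle : ∀ᶠ s in 𝓝[>] t, φ s ≤ φ t) : a ≤ 0 := by
  have h1 := (hasDerivWithinAt_iff_tendsto_slope' (s := Ioi t) (by simp)).mp h.hasDerivWithinAt
  refine le_of_tendsto h1 ?_
  filter_upwards [hle, eventually_mem_nhdsWithin] with s hs hst
  rw [slope_def_field]
  exact div_nonpos_of_nonpos_of_nonneg (by linarith) (sub_nonneg.mpr (le_of_lt hst))

theorem fderiv_eq_inner_gradient {n : ℕ} (u : En n → ℝ) (y d : En n) :
    fderiv ℝ u y d = ⟪gradient u y, d⟫ := by
  rw [gradient, InnerProductSpace.toDual_symm_apply]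

theorem hasDerivAt_inner_gradient {n : ℕ} {u : En n → ℝ} {y : En n}
    (hu : DifferentiableAt ℝ u y) (d : En n) :
    HasDerivAt (fun s : ℝ => u (y + s • d)) ⟪gradient u y, d⟫ 0 := by
  have := hasDerivAt_comp_line (w := u) (y := y) (ξ := d) (s := 0) (by simpa using hu)
  rwa [zero_smul, add_zero, fderiv_eq_inner_gradient] at this

theorem isLocalMin_suppFun_sub {n : ℕ} {Ω₁ Ω₂ : Set (En n)} {c : ℝ} {x : En n} (hx : ‖x‖ = 1)
    (hle : ∀ z : En n, ‖z‖ = 1 → c * suppFun Ω₁ z ≤ suppFun Ω₂ z)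
    (heq : c * suppFun Ω₁ x = suppFun Ω₂ x) :
    IsLocalMin (fun z => suppFun Ω₂ z - c * suppFun Ω₁ z) x := by
  have hx0 := ne_zero_of_norm_eq_one hx
  filter_upwards [isOpen_compl_singleton.mem_nhds hx0] with z hz
  have hz0 : z ≠ 0 := hz
  rw [heq, sub_self, suppFun_eq_norm_mul Ω₂ hz0, suppFun_eq_norm_mul Ω₁ hz0]
  have h1 := hle (‖z‖⁻¹ • z) (by
    rw [norm_smul, norm_inv, norm_norm, inv_mul_cancel₀ (norm_ne_zero_iff.mpr hz0)])
  nlinarith [norm_nonneg z]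

theorem gradient_suppFun_of_touching {n : ℕ} {Ω₁ Ω₂ : Set (En n)}
    (hΩ₁ : IsSmoothStrictlyConvexBody n Ω₁) (hΩ₂ : IsSmoothStrictlyConvexBody n Ω₂) {c : ℝ}
    (hc : 0 < c) {x : En n} (hx : ‖x‖ = 1)
    (hle : ∀ z : En n, ‖z‖ = 1 → c * suppFun Ω₁ z ≤ suppFun Ω₂ z)
    (heq : c * suppFun Ω₁ x = suppFun Ω₂ x) :
    gradient (suppFun Ω₂) x = c • gradient (suppFun Ω₁) x := by
  have hx0 := ne_zero_of_norm_eq_one hx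
  obtain ⟨h1, h2⟩ := gradient_suppFun_mem hΩ₁ hx0
  refine gradient_suppFun_eq hΩ₂ hx0 (smul_mem_of_mul_suppFun_le hΩ₁.body hΩ₂.body hc.le hle h1) ?_
  rw [real_inner_smul_right, h2, heq]

theorem norm_gradient_le_of_touching {n k : ℕ} (hk1 : 1 ≤ k) (hk : k + 1 ≤ n)
    {Ω₁ Ω₂ : Set (En n)} {u₁ u₂ : En n → ℝ}
    (hΩ₁ : IsSmoothStrictlyConvexBody n Ω₁) (hΩ₂ : IsSmoothStrictlyConvexBody n Ω₂)
    (h₁ : IsAdmissibleSolution n k Ω₁ u₁) (h₂ : IsAdmissibleSolution n k Ω₂ u₂) {c : ℝ}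
    (hc : 0 < c) {x : En n} (hx : ‖x‖ = 1)
    (hle : ∀ z : En n, ‖z‖ = 1 → c * suppFun Ω₁ z ≤ suppFun Ω₂ z)
    (heq : c * suppFun Ω₁ x = suppFun Ω₂ x) :
    c * ‖gradient u₁ (gradient (suppFun Ω₁) x)‖ ≤ ‖gradient u₂ (gradient (suppFun Ω₂) x)‖ := by
  have hx0 := ne_zero_of_norm_eq_one hx
  have hgrad := gradient_suppFun_of_touching hΩ₁ hΩ₂ hc hx hle heq
  have hf₁ := gradient_suppFun_mem_frontier hΩ₁ hx0
  have hf₂ := gradient_suppFun_mem_frontier hΩ₂ hx0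
  have hsub : ∀ y ∈ Ω₁, c • y ∈ Ω₂ := fun y hy =>
    smul_mem_of_mul_suppFun_le hΩ₁.body hΩ₂.body hc.le hle hy
  rw [hgrad] at hf₂ ⊢
  have hin := fun d hd => eventually_gradient_suppFun_add_mem hΩ₁ hx (d := d) hd
  set y := gradient (suppFun Ω₁) x
  have hu₁ := (h₁.contDiffAt y).differentiableAt (by norm_num)
  have hu₂ := (h₂.contDiffAt (c • y)).differentiableAt (by norm_num)
  have hn : ‖c • gradient u₁ y‖ = c * ‖gradient u₁ y‖ := by
    rw [norm_smul, Real.norm_of_nonneg hc.le]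
  rw [← hn]
  refine norm_le_of_forall_inner_le hx fun d hd => ⟨?_, ?_⟩
  · have h3 := (hasDerivAt_inner_gradient hu₂ (c • d)).sub
      ((hasDerivAt_inner_gradient hu₁ d).const_mul (c ^ 2))
    have h4 := h3.nonpos_of_eventually_le (by
      filter_upwards [hin d hd] with s hs
      have h5 := h₁.le_of_forall_smul_mem hk1 hk hΩ₁.body hΩ₂.body h₂ hc hsub hs
      have h6 : c • (y + s • d) = c • y + s • c • d := by module
      rw [h6] at h5
      simp only [Pi.sub_apply, zero_smul, add_zero, h₁.bd y hf₁, h₂.bd _ hf₂]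
      linarith)
    rw [real_inner_smul_right] at h4
    rw [real_inner_smul_left]
    nlinarith
  · rw [real_inner_smul_left]
    refine mul_nonpos_of_nonneg_of_nonpos hc.le ?_
    refine (hasDerivAt_inner_gradient hu₁ d).nonpos_of_eventually_le ?_
    filter_upwards [hin d hd] with s hs
    rw [zero_smul, add_zero, h₁.bd y hf₁]
    exact h₁.nonpos hk1 hk hΩ₁.body hs

/-- The speed of the non-normalized flow: `(h²/f) ρ^{p-n} |Du|^{k+1} σ_{n-k}`. -/
noncomputable def flowSpeed (n k : ℕ) (p : ℝ) (Ω : Set (En n)) (u : En n → ℝ) (f : En n → ℝ)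
    (x : En n) : ℝ :=
  (suppFun Ω x) ^ 2 / f x * ‖gradient (suppFun Ω) x‖ ^ (p - (n : ℝ)) *
    ‖gradient u (gradient (suppFun Ω) x)‖ ^ (k + 1) * esym n (n - k) (hessMat (suppFun Ω) x)

/-- Comparison of flow speeds at a point where a dilate of `Ω₁` touches `Ω₂` from inside. -/
theorem flowSpeed_le_of_touching {n k : ℕ} {p : ℝ} (hk1 : 1 ≤ k) (hk : k + 1 ≤ n)
    {Ω₁ Ω₂ : Set (En n)} {u₁ u₂ f : En n → ℝ}
    (hΩ₁ : IsSmoothStrictlyConvexBody n Ω₁) (hΩ₂ : IsSmoothStrictlyConvexBody n Ω₂)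
    (h₁ : IsAdmissibleSolution n k Ω₁ u₁) (h₂ : IsAdmissibleSolution n k Ω₂ u₂) {c : ℝ}
    (hc : 0 < c) {x : En n} (hx : ‖x‖ = 1) (hf : 0 < f x)
    (hle : ∀ z : En n, ‖z‖ = 1 → c * suppFun Ω₁ z ≤ suppFun Ω₂ z)
    (heq : c * suppFun Ω₁ x = suppFun Ω₂ x) :
    c ^ (p + 3) * flowSpeed n k p Ω₁ u₁ f x ≤ flowSpeed n k p Ω₂ u₂ f x := by
  have hx0 := ne_zero_of_norm_eq_one hx
  have hgrad := gradient_suppFun_of_touching hΩ₁ hΩ₂ hc hx hle heq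
  have hnorm := norm_gradient_le_of_touching hk1 hk hΩ₁ hΩ₂ h₁ h₂ hc hx hle heq
  have hc₁ := hΩ₁.contDiffAt hx0
  have hpsd₁ := posSemidef_hessMat_suppFun hΩ₁ hx0
  have hes : c ^ (n - k) * esym n (n - k) (hessMat (suppFun Ω₁) x)
      ≤ esym n (n - k) (hessMat (suppFun Ω₂) x) := by
    have h3 := esym_hessMat_le_of_isLocalMin (k := n - k) (by omega) (hΩ₂.contDiffAt hx0)
      (contDiffAt_const.mul hc₁) (isLocalMin_suppFun_sub hx hle heq) (fun j hj => by
        rw [hessMat_const_mul, esym_smul (by omega) _ hc.ne']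
        exact mul_nonneg (by positivity) (esym_nonneg_of_posSemidef hpsd₁ (by omega)))
    rwa [hessMat_const_mul, esym_smul (by omega) _ hc.ne'] at h3
  have hes₁ : 0 ≤ esym n (n - k) (hessMat (suppFun Ω₁) x) :=
    esym_nonneg_of_posSemidef hpsd₁ (by omega)
  have hgp : (c * ‖gradient u₁ (gradient (suppFun Ω₁) x)‖) ^ (k + 1)
      ≤ ‖gradient u₂ (gradient (suppFun Ω₂) x)‖ ^ (k + 1) :=
    pow_le_pow_left₀ (by positivity) hnorm _
  have hcp : c ^ (p + 3) = c ^ 2 * c ^ (p - (n : ℝ)) * c ^ (k + 1) * c ^ (n - k) := by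
    rw [← Real.rpow_natCast c 2, ← Real.rpow_natCast c (k + 1), ← Real.rpow_natCast c (n - k),
      ← Real.rpow_add hc, ← Real.rpow_add hc, ← Real.rpow_add hc]
    congr 1
    rw [Nat.cast_sub (by omega)]
    push_cast
    ring
  have hpre : 0 ≤ (suppFun Ω₂ x) ^ 2 / f x * ‖gradient (suppFun Ω₂) x‖ ^ (p - (n : ℝ)) := by
    positivity
  have hpre_eq : (suppFun Ω₂ x) ^ 2 / f x * ‖gradient (suppFun Ω₂) x‖ ^ (p - (n : ℝ))
      = (c ^ 2 * c ^ (p - (n : ℝ))) *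
        ((suppFun Ω₁ x) ^ 2 / f x * ‖gradient (suppFun Ω₁) x‖ ^ (p - (n : ℝ))) := by
    rw [← heq, hgrad, norm_smul, Real.norm_of_nonneg hc.le,
      Real.mul_rpow hc.le (norm_nonneg _)]
    ring
  calc c ^ (p + 3) * flowSpeed n k p Ω₁ u₁ f x
      = (suppFun Ω₂ x) ^ 2 / f x * ‖gradient (suppFun Ω₂) x‖ ^ (p - (n : ℝ)) *
          ((c * ‖gradient u₁ (gradient (suppFun Ω₁) x)‖) ^ (k + 1) *
            (c ^ (n - k) * esym n (n - k) (hessMat (suppFun Ω₁) x))) := by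
        rw [hpre_eq, hcp, flowSpeed]
        ring
    _ ≤ (suppFun Ω₂ x) ^ 2 / f x * ‖gradient (suppFun Ω₂) x‖ ^ (p - (n : ℝ)) *
          (‖gradient u₂ (gradient (suppFun Ω₂) x)‖ ^ (k + 1) *
            esym n (n - k) (hessMat (suppFun Ω₂) x)) :=
        mul_le_mul_of_nonneg_left (mul_le_mul hgp hes (by positivity) (by positivity)) hpre
    _ = flowSpeed n k p Ω₂ u₂ f x := by
        rw [flowSpeed]
        ring

theorem eventually_smul_mem_of_mem_interior {n : ℕ} {Ω : Set (En n)} {z : En n}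
    (hz : z ∈ interior Ω) : ∀ᶠ c : ℝ in 𝓝 1, c • z ∈ Ω := by
  have : Tendsto (fun c : ℝ => c • z) (𝓝 1) (𝓝 z) := by
    simpa using (show Continuous fun c : ℝ => c • z by fun_prop).tendsto 1
  exact this.eventually (mem_interior_iff_mem_nhds.mp hz)

theorem isGreatest_radialFun {n : ℕ} {Ω : Set (En n)} (h : IsConvexBodyO n Ω) {v : En n}
    (hv : ‖v‖ = 1) : IsGreatest {c : ℝ | 0 < c ∧ c • v ∈ Ω} (radialFun Ω v) := by
  obtain ⟨R, hR⟩ := h.comp.isBounded.exists_norm_le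
  obtain ⟨s, hs, hs2⟩ : ∃ s : ℝ, 0 < s ∧ s • v ∈ Ω := by
    have h1 : ∀ᶠ s : ℝ in 𝓝 0, s • v ∈ Ω := by
      have : Tendsto (fun s : ℝ => s • v) (𝓝 0) (𝓝 0) := by
        simpa using (show Continuous fun s : ℝ => s • v by fun_prop).tendsto 0
      exact this.eventually (mem_interior_iff_mem_nhds.mp h.zeroInt)
    have h2 : ∀ᶠ s : ℝ in 𝓝[>] 0, s • v ∈ Ω := h1.filter_mono nhdsWithin_le_nhds
    exact ((eventually_mem_nhdsWithin (a := (0 : ℝ)) (s := Ioi 0)).and h2).exists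
  set K : Set ℝ := {c : ℝ | s ≤ c ∧ c • v ∈ Ω} with hK
  have hKc : IsCompact K := by
    refine Metric.isCompact_of_isClosed_isBounded ?_ ?_
    · exact isClosed_Ici.inter (h.comp.isClosed.preimage (by fun_prop))
    · refine (Metric.isBounded_Icc s R).subset fun c hc => ⟨hc.1, ?_⟩
      have := hR _ hc.2
      rw [norm_smul, hv, mul_one] at this
      exact (le_abs_self c).trans this
  obtain ⟨m, hm⟩ := hKc.exists_isGreatest ⟨s, le_rfl, hs2⟩
  have hg : IsGreatest {c : ℝ | 0 < c ∧ c • v ∈ Ω} m := by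
    refine ⟨⟨hs.trans_le hm.1.1, hm.1.2⟩, fun c hc => ?_⟩
    rcases le_total s c with hsc | hsc
    · exact hm.2 ⟨hsc, hc.2⟩
    · exact hsc.trans hm.1.1
  rw [radialFun, hg.csSup_eq]
  exact hg

theorem radialFun_smul_mem_frontier {n : ℕ} {Ω : Set (En n)} (h : IsConvexBodyO n Ω) {v : En n}
    (hv : ‖v‖ = 1) : radialFun Ω v • v ∈ frontier Ω := by
  have hg := isGreatest_radialFun h hv
  refine h.mem_frontier_of_notMem_interior hg.1.2 fun hint => ?_
  have h2 := (eventually_smul_mem_of_mem_interior hint).filter_mono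
    (nhdsWithin_le_nhds (s := Ioi 1))
  obtain ⟨c, hc, hc2⟩ := ((eventually_mem_nhdsWithin (a := (1 : ℝ)) (s := Ioi 1)).and h2).exists
  rw [smul_smul] at hc2
  have hc1 : (1 : ℝ) < c := hc
  have hpos : 0 < radialFun Ω v := hg.1.1
  have := hg.2 ⟨by positivity, hc2⟩
  nlinarith

theorem mul_radialFun_le {n : ℕ} {Ω₁ Ω₂ : Set (En n)} (h₁ : IsConvexBodyO n Ω₁)
    (h₂ : IsConvexBodyO n Ω₂) {c : ℝ} (hc : 0 < c) (hsub : ∀ y ∈ Ω₁, c • y ∈ Ω₂) {v : En n}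
    (hv : ‖v‖ = 1) : c * radialFun Ω₁ v ≤ radialFun Ω₂ v := by
  have hg := isGreatest_radialFun h₁ hv
  refine (isGreatest_radialFun h₂ hv).2 ⟨mul_pos hc hg.1.1, ?_⟩
  rw [← smul_smul]
  exact hsub _ hg.1.2

theorem norm_fderiv_fderiv_le {n : ℕ} (w : En n → ℝ) (y : En n) :
    ‖fderiv ℝ (fderiv ℝ w) y‖ ≤ ‖iteratedFDeriv ℝ 2 w y‖ := by
  refine ContinuousLinearMap.opNorm_le_bound₂ _ (norm_nonneg _) fun a b => ?_
  have := (iteratedFDeriv ℝ 2 w y).le_opNorm ![a, b]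
  simpa [iteratedFDeriv_two_apply, Fin.prod_univ_two, mul_assoc] using this

theorem norm_fderiv_sub_le_of_convex {n : ℕ} {Ω : Set (En n)} (hΩ : Convex ℝ Ω) {w : En n → ℝ}
    (hw : ∀ y, ContDiffAt ℝ 2 w y) {C : ℝ}
    (hC : ∀ y ∈ Ω, ‖iteratedFDeriv ℝ 2 w y‖ ≤ C) {y z : En n} (hy : y ∈ Ω) (hz : z ∈ Ω) :
    ‖fderiv ℝ w z - fderiv ℝ w y‖ ≤ C * ‖z - y‖ :=
  hΩ.norm_image_sub_le_of_norm_fderiv_le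
    (fun x _ => differentiableAt_fderiv_of_contDiffAt_two (hw x))
    (fun x hx => (norm_fderiv_fderiv_le w x).trans (hC x hx)) hy hz

theorem abs_sub_sub_inner_gradient_le {n : ℕ} {Ω : Set (En n)} (hΩ : Convex ℝ Ω) {w : En n → ℝ}
    (hw : ∀ y, ContDiffAt ℝ 2 w y) {C : ℝ} (hC0 : 0 ≤ C)
    (hC : ∀ y ∈ Ω, ‖iteratedFDeriv ℝ 2 w y‖ ≤ C) {y z : En n} (hy : y ∈ Ω) (hz : z ∈ Ω) :
    |w z - w y - ⟪gradient w y, z - y⟫| ≤ C * ‖z - y‖ ^ 2 := by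
  have h := (convex_segment y z).norm_image_sub_le_of_norm_fderiv_le' (𝕜 := ℝ) (f := w)
    (φ := fderiv ℝ w y) (C := C * ‖z - y‖) (fun x _ => (hw x).differentiableAt (by norm_num))
    (fun x hx => by
      refine (norm_fderiv_sub_le_of_convex hΩ hw hC hy (hΩ.segment_subset hy hz hx)).trans ?_
      refine mul_le_mul_of_nonneg_left ?_ hC0
      obtain ⟨a, b, ha, hb, hab, rfl⟩ := hx
      have : a • y + b • z - y = b • (z - y) := by
        rw [show a = 1 - b by linarith]
        module
      rw [this, norm_smul, Real.norm_of_nonneg hb]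
      exact mul_le_of_le_one_left (norm_nonneg _) (by linarith))
    (left_mem_segment ℝ y z) (right_mem_segment ℝ y z)
  rw [fderiv_eq_inner_gradient, Real.norm_eq_abs] at h
  calc _ ≤ _ := h
    _ = _ := by ring

theorem norm_gradient_sub_le {n : ℕ} (w : En n → ℝ) (y z : En n) :
    ‖gradient w z - gradient w y‖ = ‖fderiv ℝ w z - fderiv ℝ w y‖ := by
  rw [gradient, gradient, ← map_sub, LinearIsometryEquiv.norm_map]

theorem norm_le_of_mem_of_suppFun_le {n : ℕ} {Ω : Set (En n)} (h : IsConvexBodyO n Ω) {C : ℝ}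
    (hC0 : 0 ≤ C) (hC : ∀ x : En n, ‖x‖ = 1 → suppFun Ω x ≤ C) {y : En n} (hy : y ∈ Ω) :
    ‖y‖ ≤ C := by
  rcases eq_or_ne y 0 with rfl | hy0
  · simpa using hC0
  have h1 := inner_le_suppFun h.comp y hy
  rw [suppFun_eq_norm_mul Ω hy0, real_inner_self_eq_norm_sq] at h1
  have h2 := hC (‖y‖⁻¹ • y) (by
    rw [norm_smul, norm_inv, norm_norm, inv_mul_cancel₀ (norm_ne_zero_iff.mpr hy0)])
  have h3 := norm_pos_iff.mpr hy0
  nlinarith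

theorem abs_suppFun_sub_le {n : ℕ} {Ω : Set (En n)} (h : IsConvexBodyO n Ω) {C : ℝ}
    (hC0 : 0 ≤ C) (hC : ∀ x : En n, ‖x‖ = 1 → suppFun Ω x ≤ C) (x z : En n) :
    |suppFun Ω x - suppFun Ω z| ≤ C * ‖x - z‖ := by
  have key : ∀ a b : En n, suppFun Ω a - suppFun Ω b ≤ C * ‖a - b‖ := by
    intro a b
    obtain ⟨y, hy, hay⟩ := exists_inner_eq_suppFun h.comp h.nonempty a
    have h1 := inner_le_suppFun h.comp b hy
    have h2 := real_inner_le_norm (a - b) y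
    have h3 := norm_le_of_mem_of_suppFun_le h hC0 hC hy
    rw [inner_sub_left] at h2
    nlinarith [norm_nonneg (a - b)]
  rw [abs_le]
  refine ⟨?_, key x z⟩
  have := key z x
  rw [norm_sub_rev] at this
  linarith

/-- Hypotheses ensuring that support functions vary continuously in time. -/
structure IsContinuousFamily (n : ℕ) (I : Set ℝ) (Ω : ℝ → Set (En n)) (C : ℝ) : Prop where
  body : ∀ t ∈ I, IsConvexBodyO n (Ω t)
  nonneg : 0 ≤ C
  le : ∀ t ∈ I, ∀ x : En n, ‖x‖ = 1 → suppFun (Ω t) x ≤ C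
  cont : ∀ x : En n, ‖x‖ = 1 → ContinuousOn (fun t => suppFun (Ω t) x) I

theorem IsContinuousFamily.continuousOn {n : ℕ} {I : Set ℝ} {Ω : ℝ → Set (En n)} {C : ℝ}
    (h : IsContinuousFamily n I Ω C) :
    ContinuousOn (fun q : ℝ × En n => suppFun (Ω q.1) q.2) (I ×ˢ Metric.sphere 0 1) := by
  refine continuousOn_prod_of_continuousOn_lipschitzOnWith'
    (fun q : ℝ × En n => suppFun (Ω q.1) q.2) ⟨C, h.nonneg⟩ (fun t ht => ?_) (fun x hx => ?_)
  · refine LipschitzOnWith.of_dist_le_mul fun x _ z _ => ?_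
    rw [Real.dist_eq, dist_eq_norm]
    exact abs_suppFun_sub_le (h.body t ht) h.nonneg (h.le t ht) x z
  · exact h.cont x (by simpa using hx)

theorem IsContinuousFamily.eventually_mul_suppFun_lt {n : ℕ} {I : Set ℝ} {Ω : ℝ → Set (En n)}
    {C : ℝ} (h : IsContinuousFamily n I Ω C) {t₀ : ℝ} (ht₀ : t₀ ∈ I) {c : ℝ} (hc : c < 1) :
    ∀ᶠ t in 𝓝[I] t₀, ∀ x : En n, ‖x‖ = 1 →
      c * suppFun (Ω t₀) x ≤ suppFun (Ω t) x ∧ c * suppFun (Ω t) x ≤ suppFun (Ω t₀) x := by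
  rw [eventually_nhdsWithin_iff]
  have hev := (isCompact_sphere (0 : En n) 1).eventually_forall_of_forall_eventually (x₀ := t₀)
    (P := fun t x => (t, x) ∈ I ×ˢ Metric.sphere (0 : En n) 1 →
      c * suppFun (Ω t₀) x < suppFun (Ω t) x ∧ c * suppFun (Ω t) x < suppFun (Ω t₀) x) (by
    intro x hx
    have hF := h.continuousOn (t₀, x) ⟨ht₀, hx⟩
    have hF₀ : ContinuousWithinAt (fun q : ℝ × En n => suppFun (Ω t₀) q.2)
        (I ×ˢ Metric.sphere 0 1) (t₀, x) := by
      have : ContinuousWithinAt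
          ((fun q : ℝ × En n => suppFun (Ω q.1) q.2) ∘ fun q : ℝ × En n => (t₀, q.2))
          (I ×ˢ Metric.sphere 0 1) (t₀, x) :=
        ContinuousWithinAt.comp (t := I ×ˢ Metric.sphere 0 1) hF
          (by fun_prop) fun q hq => ⟨ht₀, hq.2⟩
      exact this
    have hpos : 0 < suppFun (Ω t₀) x :=
      suppFun_pos (h.body t₀ ht₀) (ne_zero_of_norm_eq_one (by simpa using hx))
    have h1 := (hF₀.const_mul c).eventually_lt hF (by simp only; nlinarith)
    have h2 := (hF.const_mul c).eventually_lt hF₀ (by simp only; nlinarith)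
    rw [← eventually_nhdsWithin_iff (p := fun q : ℝ × En n =>
      c * suppFun (Ω t₀) q.2 < suppFun (Ω q.1) q.2 ∧ c * suppFun (Ω q.1) q.2 < suppFun (Ω t₀) q.2)]
    exact h1.and h2)
  filter_upwards [hev] with t ht hI x hx
  have := ht x (by simpa using hx) ⟨hI, by simpa using hx⟩
  exact ⟨this.1.le, this.2.le⟩

theorem IsContinuousFamily.eventually_smul_mem {n : ℕ} {I : Set ℝ} {Ω : ℝ → Set (En n)}
    {C : ℝ} (h : IsContinuousFamily n I Ω C) {t₀ : ℝ} (ht₀ : t₀ ∈ I) {c : ℝ} (hc0 : 0 ≤ c)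
    (hc : c < 1) :
    ∀ᶠ t in 𝓝[I] t₀, (∀ y ∈ Ω t₀, c • y ∈ Ω t) ∧ ∀ y ∈ Ω t, c • y ∈ Ω t₀ := by
  filter_upwards [h.eventually_mul_suppFun_lt ht₀ hc, eventually_mem_nhdsWithin] with t ht hI
  exact ⟨fun y hy => smul_mem_of_mul_suppFun_le (h.body t₀ ht₀) (h.body t hI) hc0
      (fun x hx => (ht x hx).1) hy,
    fun y hy => smul_mem_of_mul_suppFun_le (h.body t hI) (h.body t₀ ht₀) hc0
      (fun x hx => (ht x hx).2) hy⟩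

theorem IsContinuousFamily.eventually_mem {n : ℕ} {I : Set ℝ} {Ω : ℝ → Set (En n)}
    {C : ℝ} (h : IsContinuousFamily n I Ω C) {t₀ : ℝ} (ht₀ : t₀ ∈ I) {z : En n}
    (hz : z ∈ interior (Ω t₀)) : ∀ᶠ t in 𝓝[I] t₀, z ∈ Ω t := by
  have h1 : ∀ᶠ c : ℝ in 𝓝 1, c⁻¹ • z ∈ Ω t₀ := by
    have : Tendsto (fun c : ℝ => c⁻¹) (𝓝 1) (𝓝 1) := by
      simpa using tendsto_inv₀ (one_ne_zero (α := ℝ))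
    exact this.eventually (eventually_smul_mem_of_mem_interior hz)
  have h2 := (h1.and (lt_mem_nhds zero_lt_one)).filter_mono
    (nhdsWithin_le_nhds (s := Iio (1 : ℝ)))
  obtain ⟨c, hc1, hc2, hc0⟩ := ((eventually_mem_nhdsWithin (s := Iio (1 : ℝ))).and h2).exists
  filter_upwards [h.eventually_smul_mem ht₀ hc0.le hc1] with t ht
  have := ht.1 _ hc2
  rwa [smul_inv_smul₀ hc0.ne'] at this

theorem IsContinuousFamily.tendsto_radialFun {n : ℕ} {I : Set ℝ} {Ω : ℝ → Set (En n)}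
    {C : ℝ} (h : IsContinuousFamily n I Ω C) {t₀ : ℝ} (ht₀ : t₀ ∈ I) {v : En n}
    (hv : ‖v‖ = 1) :
    Tendsto (fun t => radialFun (Ω t) v) (𝓝[I] t₀) (𝓝 (radialFun (Ω t₀) v)) := by
  have hpos : 0 < radialFun (Ω t₀) v := (isGreatest_radialFun (h.body t₀ ht₀) hv).1.1
  have hc : ∀ c : ℝ, 0 < c → c < 1 → ∀ᶠ t in 𝓝[I] t₀,
      c * radialFun (Ω t₀) v ≤ radialFun (Ω t) v ∧ c * radialFun (Ω t) v ≤ radialFun (Ω t₀) v := by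
    intro c h0 h1
    filter_upwards [h.eventually_smul_mem ht₀ h0.le h1, eventually_mem_nhdsWithin] with t ht hI
    exact ⟨mul_radialFun_le (h.body t₀ ht₀) (h.body t hI) h0 ht.1 hv,
      mul_radialFun_le (h.body t hI) (h.body t₀ ht₀) h0 ht.2 hv⟩
  set r := radialFun (Ω t₀) v
  have hIoo : ∀ᶠ c in 𝓝[<] (1 : ℝ), c ∈ Ioo (0 : ℝ) 1 := Ioo_mem_nhdsLT zero_lt_one
  refine tendsto_order.mpr ⟨fun a ha => ?_, fun a ha => ?_⟩
  · have h1 : ∀ᶠ c : ℝ in 𝓝[<] 1, a < c * r := by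
      have : Tendsto (fun c : ℝ => c * r) (𝓝[<] 1) (𝓝 r) := by
        simpa using ((show Continuous fun c : ℝ => c * r by fun_prop).tendsto 1).mono_left
          (nhdsWithin_le_nhds (s := Iio 1))
      exact this.eventually (lt_mem_nhds ha)
    obtain ⟨c, ⟨hc0, hc1⟩, hca⟩ := (hIoo.and h1).exists
    filter_upwards [hc c hc0 hc1] with t ht
    exact hca.trans_le ht.1
  · have h1 : ∀ᶠ c : ℝ in 𝓝[<] 1, r < c * a := by
      have : Tendsto (fun c : ℝ => c * a) (𝓝[<] 1) (𝓝 a) := by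
        simpa using ((show Continuous fun c : ℝ => c * a by fun_prop).tendsto 1).mono_left
          (nhdsWithin_le_nhds (s := Iio 1))
      exact this.eventually (lt_mem_nhds ha)
    obtain ⟨c, ⟨hc0, hc1⟩, hca⟩ := (hIoo.and h1).exists
    filter_upwards [hc c hc0 hc1] with t ht
    exact lt_of_mul_lt_mul_left (ht.2.trans_lt hca) hc0.le

theorem IsContinuousFamily.tendsto_admissibleSolution {n k : ℕ} (hk1 : 1 ≤ k) (hk : k + 1 ≤ n)
    {I : Set ℝ} {Ω : ℝ → Set (En n)} {C : ℝ} (h : IsContinuousFamily n I Ω C)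
    {u : ℝ → En n → ℝ} (hu : ∀ t ∈ I, IsAdmissibleSolution n k (Ω t) (u t)) {t₀ : ℝ}
    (ht₀ : t₀ ∈ I) {z : En n} (hz : z ∈ interior (Ω t₀)) :
    Tendsto (fun t => u t z) (𝓝[I] t₀) (𝓝 (u t₀ z)) := by
  have hcont := (hu t₀ ht₀).smooth.continuous
  have hup : Tendsto (fun c : ℝ => c ^ 2 * u t₀ (c⁻¹ • z)) (𝓝[<] 1) (𝓝 (u t₀ z)) := by
    have h1 : ContinuousAt (fun c : ℝ => c ^ 2 * u t₀ (c⁻¹ • z)) 1 := by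
      refine (continuousAt_id.pow 2).mul (hcont.continuousAt.comp ?_)
      exact (continuousAt_inv₀ one_ne_zero).smul continuousAt_const
    simpa [ContinuousAt] using h1.tendsto.mono_left (nhdsWithin_le_nhds (s := Iio 1))
  have hlow : Tendsto (fun c : ℝ => (c ^ 2)⁻¹ * u t₀ (c • z)) (𝓝[<] 1) (𝓝 (u t₀ z)) := by
    have h1 : ContinuousAt (fun c : ℝ => (c ^ 2)⁻¹ * u t₀ (c • z)) 1 := by
      refine ((continuousAt_id.pow 2).inv₀ (by simp)).mul (hcont.continuousAt.comp ?_)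
      exact continuousAt_id.smul continuousAt_const
    simpa [ContinuousAt] using h1.tendsto.mono_left (nhdsWithin_le_nhds (s := Iio 1))
  have hmem : ∀ᶠ c : ℝ in 𝓝[<] 1, c⁻¹ • z ∈ Ω t₀ := by
    have : Tendsto (fun c : ℝ => c⁻¹) (𝓝 1) (𝓝 1) := by
      simpa using tendsto_inv₀ (one_ne_zero (α := ℝ))
    exact (this.eventually (eventually_smul_mem_of_mem_interior hz)).filter_mono nhdsWithin_le_nhds
  have hIoo : ∀ᶠ c in 𝓝[<] (1 : ℝ), c ∈ Ioo (0 : ℝ) 1 := Ioo_mem_nhdsLT zero_lt_one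
  refine tendsto_order.mpr ⟨fun a ha => ?_, fun a ha => ?_⟩
  · obtain ⟨c, ⟨hc0, hc1⟩, hca⟩ := (hIoo.and (hlow.eventually (lt_mem_nhds ha))).exists
    filter_upwards [h.eventually_smul_mem ht₀ hc0.le hc1, h.eventually_mem ht₀ hz,
      eventually_mem_nhdsWithin] with t ht hzt hI
    have h1 := (hu t hI).le_of_forall_smul_mem hk1 hk (h.body t hI) (h.body t₀ ht₀) (hu t₀ ht₀)
      hc0 ht.2 hzt
    refine hca.trans_le ?_
    rw [inv_mul_le_iff₀ (by positivity)]
    exact h1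
  · obtain ⟨c, ⟨⟨hc0, hc1⟩, hcm⟩, hca⟩ :=
      ((hIoo.and hmem).and (hup.eventually (gt_mem_nhds ha))).exists
    filter_upwards [h.eventually_smul_mem ht₀ hc0.le hc1, eventually_mem_nhdsWithin] with t ht hI
    have h1 := (hu t₀ ht₀).le_of_forall_smul_mem hk1 hk (h.body t₀ ht₀) (h.body t hI) (hu t hI)
      hc0 ht.1 hcm
    rw [smul_inv_smul₀ hc0.ne'] at h1
    exact h1.trans_lt hca

theorem tendsto_of_forall_tendsto_inner_sub {n : ℕ} {ι : Type*} {l : Filter ι} {g : ι → En n}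
    {g₀ : En n} (h : ∀ w : En n, Tendsto (fun t => ⟪g t - g₀, w⟫) l (𝓝 0)) :
    Tendsto g l (𝓝 g₀) := by
  rw [tendsto_iff_norm_sub_tendsto_zero]
  have h1 : Tendsto (fun t => √(∑ i, ‖⟪g t - g₀, EuclideanSpace.single i (1 : ℝ)⟫‖ ^ 2)) l
      (𝓝 √(∑ _i : Fin n, ‖(0 : ℝ)‖ ^ 2)) :=
    (tendsto_finsetSum _ fun i _ => ((h _).norm.pow 2)).sqrt
  simpa [EuclideanSpace.norm_eq, EuclideanSpace.inner_single_right] using h1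

theorem IsContinuousFamily.tendsto_inner_gradient_sub {n k : ℕ} (hk1 : 1 ≤ k) (hk : k + 1 ≤ n)
    {I : Set ℝ} {Ω : ℝ → Set (En n)} {C : ℝ} (h : IsContinuousFamily n I Ω C)
    {u : ℝ → En n → ℝ} (hu : ∀ t ∈ I, IsAdmissibleSolution n k (Ω t) (u t)) {K M : ℝ}
    (hK0 : 0 ≤ K) (hK : ∀ t ∈ I, ∀ y ∈ Ω t, ‖iteratedFDeriv ℝ 2 (u t) y‖ ≤ K)
    (hM : ∀ t ∈ I, ∀ y ∈ Ω t, ‖gradient (u t) y‖ ≤ M) {t₀ : ℝ}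
    (ht₀ : t₀ ∈ I) {v : En n} (hv : ‖v‖ = 1) {z : En n} (hz : z ∈ interior (Ω t₀)) :
    Tendsto (fun t => ⟪gradient (u t) (radialFun (Ω t) v • v)
      - gradient (u t₀) (radialFun (Ω t₀) v • v), z - radialFun (Ω t₀) v • v⟫)
      (𝓝[I] t₀) (𝓝 0) := by
  set y : ℝ → En n := fun t => radialFun (Ω t) v • v with hy
  have hyt : Tendsto y (𝓝[I] t₀) (𝓝 (y t₀)) := (h.tendsto_radialFun ht₀ hv).smul_const v
  have hyΩ : ∀ t ∈ I, y t ∈ Ω t := fun t ht => (isGreatest_radialFun (h.body t ht) hv).1.2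
  have hybd : ∀ t ∈ I, u t (y t) = 0 := fun t ht =>
    (hu t ht).bd _ (radialFun_smul_mem_frontier (h.body t ht) hv)
  set g : ℝ → En n := fun t => gradient (u t) (y t) with hg
  change Tendsto (fun t => ⟪g t - g t₀, z - y t₀⟫) (𝓝[I] t₀) (𝓝 0)
  rw [Metric.tendsto_nhds]
  intro ε hε
  set Q := 2 * K * ‖z - y t₀‖ ^ 2 with hQ
  have hQ0 : 0 ≤ Q := by positivity
  set s := min 1 (ε / (Q + 1)) with hs
  have hs0 : 0 < s := by positivity
  have hsQ : s * Q < ε := by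
    have h1 : s * (Q + 1) ≤ ε := by
      rw [← le_div_iff₀ (by positivity)]
      exact min_le_right _ _
    nlinarith
  set z' := y t₀ + s • (z - y t₀) with hz'
  have hzint : z' ∈ interior (Ω t₀) :=
    (h.body t₀ ht₀).conv.add_smul_sub_mem_interior (hyΩ t₀ ht₀) hz ⟨hs0, min_le_left _ _⟩
  have hz'y : z' - y t₀ = s • (z - y t₀) := by rw [hz']; abel
  have hR : Tendsto (fun t => K * ‖z' - y t‖ ^ 2 + M * ‖y t - y t₀‖ + |u t z' - u t₀ z'|
      + K * ‖z' - y t₀‖ ^ 2) (𝓝[I] t₀) (𝓝 (K * ‖z' - y t₀‖ ^ 2 + M * ‖y t₀ - y t₀‖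
      + |u t₀ z' - u t₀ z'| + K * ‖z' - y t₀‖ ^ 2)) :=
    (((((tendsto_const_nhds.sub hyt).norm.pow 2).const_mul K).add
      ((hyt.sub_const _).norm.const_mul M)).add
      ((h.tendsto_admissibleSolution hk1 hk hu ht₀ hzint).sub_const _).abs).add_const _
  have hlim : K * ‖z' - y t₀‖ ^ 2 + M * ‖y t₀ - y t₀‖
      + |u t₀ z' - u t₀ z'| + K * ‖z' - y t₀‖ ^ 2 < s * ε := by
    rw [hz'y, norm_smul, Real.norm_of_nonneg hs0.le]
    simp only [sub_self, norm_zero, abs_zero, mul_zero, add_zero]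
    have : K * (s * ‖z - y t₀‖) ^ 2 + K * (s * ‖z - y t₀‖) ^ 2 = s * (s * Q) := by
      rw [hQ]; ring
    rw [this]
    exact mul_lt_mul_of_pos_left hsQ hs0
  filter_upwards [hR.eventually (gt_mem_nhds hlim), h.eventually_mem ht₀ hzint,
    eventually_mem_nhdsWithin] with t ht hzt hI
  rw [Real.dist_eq, sub_zero]
  have h1 := abs_sub_sub_inner_gradient_le (h.body t hI).conv (hu t hI).contDiffAt hK0 (hK t hI)
    (hyΩ t hI) hzt
  have h2 := abs_sub_sub_inner_gradient_le (h.body t₀ ht₀).conv (hu t₀ ht₀).contDiffAt hK0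
    (hK t₀ ht₀) (hyΩ t₀ ht₀) (interior_subset hzint)
  rw [hybd t hI, sub_zero] at h1
  rw [hybd t₀ ht₀, sub_zero] at h2
  have h3 : |⟪g t, y t - y t₀⟫| ≤ M * ‖y t - y t₀‖ :=
    (abs_real_inner_le_norm _ _).trans
      (mul_le_mul_of_nonneg_right (hM t hI _ (hyΩ t hI)) (norm_nonneg _))
  have h4 : s * ⟪g t - g t₀, z - y t₀⟫ = ⟪g t, z' - y t⟫ + ⟪g t, y t - y t₀⟫
      - ⟪g t₀, z' - y t₀⟫ := by
    rw [← real_inner_smul_right, ← hz'y, inner_sub_left, ← inner_add_right, sub_add_sub_cancel]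
  have h5 : |s * ⟪g t - g t₀, z - y t₀⟫| < s * ε := by
    rw [h4]
    refine lt_of_le_of_lt ?_ ht
    have e : ⟪g t, z' - y t⟫ + ⟪g t, y t - y t₀⟫ - ⟪g t₀, z' - y t₀⟫
        = -(u t z' - ⟪g t, z' - y t⟫) + ⟪g t, y t - y t₀⟫ + (u t z' - u t₀ z')
          + (u t₀ z' - ⟪g t₀, z' - y t₀⟫) := by ring
    rw [e]
    refine (abs_add_le _ _).trans (add_le_add ((abs_add_le _ _).trans (add_le_add
      ((abs_add_le _ _).trans (add_le_add ?_ h3)) le_rfl)) h2)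
    rw [abs_neg]
    exact h1
  rw [abs_mul, abs_of_pos hs0] at h5
  exact lt_of_mul_lt_mul_left h5 hs0.le

theorem IsContinuousFamily.tendsto_gradient {n k : ℕ} (hk1 : 1 ≤ k) (hk : k + 1 ≤ n)
    {I : Set ℝ} {Ω : ℝ → Set (En n)} {C : ℝ} (h : IsContinuousFamily n I Ω C)
    {u : ℝ → En n → ℝ} (hu : ∀ t ∈ I, IsAdmissibleSolution n k (Ω t) (u t)) {K M : ℝ}
    (hK0 : 0 ≤ K) (hK : ∀ t ∈ I, ∀ y ∈ Ω t, ‖iteratedFDeriv ℝ 2 (u t) y‖ ≤ K)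
    (hM : ∀ t ∈ I, ∀ y ∈ Ω t, ‖gradient (u t) y‖ ≤ M) {t₀ : ℝ}
    (ht₀ : t₀ ∈ I) {v : En n} (hv : ‖v‖ = 1) :
    Tendsto (fun t => gradient (u t) (radialFun (Ω t) v • v)) (𝓝[I] t₀)
      (𝓝 (gradient (u t₀) (radialFun (Ω t₀) v • v))) := by
  refine tendsto_of_forall_tendsto_inner_sub fun w => ?_
  have hconv := fun z hz => h.tendsto_inner_gradient_sub hk1 hk hu hK0 hK hM ht₀ hv (z := z) hz
  have h0 := (h.body t₀ ht₀).zeroInt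
  obtain ⟨δ, hδ, hδw⟩ : ∃ δ : ℝ, 0 < δ ∧ δ • w ∈ interior (Ω t₀) := by
    have h1 : Tendsto (fun s : ℝ => s • w) (𝓝 0) (𝓝 0) := by
      simpa using (show Continuous fun s : ℝ => s • w by fun_prop).tendsto 0
    have h2 : ∀ᶠ s : ℝ in 𝓝[>] 0, s • w ∈ interior (Ω t₀) :=
      (h1.eventually (isOpen_interior.mem_nhds h0)).filter_mono nhdsWithin_le_nhds
    exact ((eventually_mem_nhdsWithin (a := (0 : ℝ)) (s := Ioi 0)).and h2).exists
  have h3 := ((hconv _ hδw).sub (hconv 0 h0)).const_mul δ⁻¹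
  simp only [← inner_sub_right, sub_sub_sub_cancel_right, sub_zero, real_inner_smul_right,
    mul_zero] at h3
  refine h3.congr fun t => ?_
  rw [inv_mul_cancel_left₀ hδ.ne']

instance {n : ℕ} : IsFiniteMeasure (sphMeasure n) := by
  unfold sphMeasure
  infer_instance

theorem rpow_le_rpow_abs {C r a : ℝ} (hC : 0 < C) (h1 : 1 / C ≤ r) (h2 : r ≤ C) :
    r ^ a ≤ C ^ |a| := by
  have hr : 0 < r := (by positivity : 0 < 1 / C).trans_le h1
  rcases le_total 0 a with ha | ha
  · rw [abs_of_nonneg ha]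
    exact Real.rpow_le_rpow hr.le h2 ha
  · rw [abs_of_nonpos ha, Real.rpow_neg hC.le, ← Real.inv_rpow hC.le, inv_eq_one_div]
    exact Real.rpow_le_rpow_of_nonpos (by positivity) h1 ha

theorem integrable_QdualIntegrand_of_etaFn_pos {n k : ℕ} {p : ℝ} {Ω : ℝ → Set (En n)}
    {u : ℝ → En n → ℝ} {f : En n → ℝ} {t : ℝ} (h : 0 < etaFn n k p Ω u f t) :
    Integrable (QdualIntegrand n k p (Ω t) (u t)) (sphMeasure n) := by
  by_contra hn
  rw [etaFn, integral_undef hn, zero_div] at h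
  exact lt_irrefl _ h

theorem IsContinuousFamily.continuousOn_etaFn {n k : ℕ} {p : ℝ} (hk1 : 1 ≤ k) (hk : k + 1 ≤ n)
    {I : Set ℝ} {Ω : ℝ → Set (En n)} {C : ℝ} (h : IsContinuousFamily n I Ω C) (hC : 0 < C)
    {u : ℝ → En n → ℝ} {f : En n → ℝ} (hu : ∀ t ∈ I, IsAdmissibleSolution n k (Ω t) (u t))
    {K M : ℝ} (hK0 : 0 ≤ K) (hK : ∀ t ∈ I, ∀ y ∈ Ω t, ‖iteratedFDeriv ℝ 2 (u t) y‖ ≤ K)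
    (hM : ∀ t ∈ I, ∀ y ∈ Ω t, ‖gradient (u t) y‖ ≤ M)
    (hρ : ∀ t ∈ I, ∀ v : En n, ‖v‖ = 1 → 1 / C ≤ radialFun (Ω t) v ∧ radialFun (Ω t) v ≤ C)
    (heta : ∀ t ∈ I, 0 < etaFn n k p Ω u f t) :
    ContinuousOn (etaFn n k p Ω u f) I := by
  intro t₀ ht₀
  refine ContinuousWithinAt.div_const ?_ _
  refine continuousWithinAt_of_dominated
    (bound := fun _ => C ^ |p + 1 - (k : ℝ)| * M ^ (k + 1)) ?_ ?_ (integrable_const _) ?_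
  · filter_upwards [eventually_mem_nhdsWithin] with t ht
    exact (integrable_QdualIntegrand_of_etaFn_pos (heta t ht)).aestronglyMeasurable
  · filter_upwards [eventually_mem_nhdsWithin] with t ht
    refine Eventually.of_forall fun v => ?_
    have hv : ‖(v : En n)‖ = 1 := by simp
    have hg := isGreatest_radialFun (h.body t ht) hv
    have hr : 0 < radialFun (Ω t) v := hg.1.1
    rw [QdualIntegrand, Real.norm_of_nonneg (by positivity)]
    exact mul_le_mul (rpow_le_rpow_abs hC (hρ t ht v hv).1 (hρ t ht v hv).2)
      (pow_le_pow_left₀ (norm_nonneg _) (hM t ht _ hg.1.2) _) (by positivity) (by positivity)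
  · refine Eventually.of_forall fun v => ?_
    have hv : ‖(v : En n)‖ = 1 := by simp
    have hr : 0 < radialFun (Ω t₀) v := (isGreatest_radialFun (h.body t₀ ht₀) hv).1.1
    exact ((h.tendsto_radialFun ht₀ hv).rpow_const (Or.inl hr.ne')).mul
      ((h.tendsto_gradient hk1 hk hu hK0 hK hM ht₀ hv).norm.pow _)

theorem exists_first_touching {X : Type*} [TopologicalSpace X] {S : Set X} (hS : IsCompact S)
    {a b : ℝ} {F : ℝ × X → ℝ} (hF : ContinuousOn F (Icc a b ×ˢ S))
    (ha : ∀ x ∈ S, 0 < F (a, x)) {t₁ : ℝ} (ht₁ : t₁ ∈ Icc a b) {x₁ : X} (hx₁ : x₁ ∈ S)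
    (hneg : F (t₁, x₁) ≤ 0) :
    ∃ t ∈ Ioc a b, ∃ x ∈ S, F (t, x) = 0 ∧ (∀ z ∈ S, 0 ≤ F (t, z)) ∧
      ∀ s ∈ Ico a t, ∀ z ∈ S, 0 < F (s, z) := by
  have hc : IsCompact ((Icc a b ×ˢ S) ∩ F ⁻¹' Iic 0) := by
    obtain ⟨V, hV, hVeq⟩ := continuousOn_iff_isClosed.mp hF (Iic 0) isClosed_Iic
    rw [inter_comm, hVeq, inter_comm]
    exact (isCompact_Icc.prod hS).inter_right hV
  obtain ⟨t, ⟨⟨⟨t', x⟩, ⟨⟨ht, hx⟩, hFx⟩, htt⟩, hmin⟩⟩ :=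
    (hc.image continuous_fst).exists_isLeast ⟨t₁, (t₁, x₁), ⟨⟨ht₁, hx₁⟩, hneg⟩, rfl⟩
  obtain rfl : t' = t := htt
  have hlt : ∀ s ∈ Ico a t', ∀ z ∈ S, 0 < F (s, z) := by
    intro s hs z hz
    by_contra! hle
    have := hmin ⟨(s, z), ⟨⟨⟨hs.1, hs.2.le.trans ht.2⟩, hz⟩, hle⟩, rfl⟩
    exact absurd hs.2 (not_lt.mpr this)
  have hat : a < t' := by
    refine lt_of_le_of_ne ht.1 fun h => ?_
    subst h
    exact absurd (ha x hx) (not_lt.mpr hFx)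
  have hnonneg : ∀ z ∈ S, 0 ≤ F (t', z) := by
    intro z hz
    have h1 : ContinuousWithinAt (fun s => F (s, z)) (Ico a t') t' := by
      have := (hF (t', z) ⟨ht, hz⟩).comp (f := fun s => (s, z)) (s := Ico a t')
        (x := t') (by fun_prop) fun s hs => ⟨⟨hs.1, hs.2.le.trans ht.2⟩, hz⟩
      exact this
    have : (𝓝[Ico a t'] t').NeBot := by
      rw [← mem_closure_iff_nhdsWithin_neBot, closure_Ico hat.ne]
      exact ⟨hat.le, le_rfl⟩
    exact ge_of_tendsto h1 (eventually_mem_nhdsWithin.mono fun s hs => (hlt s hs z hz).le)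
  exact ⟨t', ⟨hat, ht.2⟩, x, hx, le_antisymm hFx (hnonneg x hx), hnonneg, hlt⟩

theorem HasDerivAt.nonpos_of_eventually_ge_left {φ : ℝ → ℝ} {a t : ℝ} (h : HasDerivAt φ a t)
    (hle : ∀ᶠ s in 𝓝[<] t, φ t ≤ φ s) : a ≤ 0 := by
  have h1 := (hasDerivWithinAt_iff_tendsto_slope' (s := Iio t) (by simp)).mp h.hasDerivWithinAt
  refine le_of_tendsto h1 ?_
  filter_upwards [hle, eventually_mem_nhdsWithin] with s hs hst
  rw [slope_def_field]
  exact div_nonpos_of_nonneg_of_nonpos (by linarith) (sub_nonpos.mpr (le_of_lt hst))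

theorem IsFlowSolution.hasDerivAt {n k : ℕ} {p : ℝ} {I : Set ℝ} {Ω : ℝ → Set (En n)}
    {u : ℝ → En n → ℝ} {f : En n → ℝ} (h : IsFlowSolution n k p I Ω u f) {t : ℝ} (ht : t ∈ I)
    {x : En n} (hx : ‖x‖ = 1) :
    HasDerivAt (fun s => suppFun (Ω s) x)
      (flowSpeed n k p (Ω t) (u t) f x - etaFn n k p Ω u f t * suppFun (Ω t) x) t :=
  h.flow t ht x hx

theorem IsFlowSolution.isContinuousFamily {n k : ℕ} {p : ℝ} {I : Set ℝ} {Ω : ℝ → Set (En n)}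
    {u : ℝ → En n → ℝ} {f : En n → ℝ} (h : IsFlowSolution n k p I Ω u f) {C : ℝ} (hC : 0 ≤ C)
    (hle : ∀ t ∈ I, ∀ x : En n, ‖x‖ = 1 → suppFun (Ω t) x ≤ C) :
    IsContinuousFamily n I Ω C where
  body t ht := (h.bodies t ht).body
  nonneg := hC
  le := hle
  cont _ hx _ ht := (h.hasDerivAt ht hx).continuousAt.continuousWithinAt

/-- Comparison principle: a dilated and time-reparametrized strict subsolution stays inside the
evolving body. -/
theorem IsFlowSolution.mul_suppFun_lt {n k : ℕ} {p : ℝ} (hk1 : 1 ≤ k) (hk : k + 1 ≤ n)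
    {I : Set ℝ} {Ω : ℝ → Set (En n)} {u : ℝ → En n → ℝ} {f : En n → ℝ}
    (h : IsFlowSolution n k p I Ω u f) {C : ℝ} (hcf : IsContinuousFamily n I Ω C)
    (hf : ∀ x : En n, ‖x‖ = 1 → 0 < f x) {a b : ℝ} (hab : Icc a b ⊆ I)
    {c c' θ θ' : ℝ → ℝ} (hc : ∀ t ∈ Icc a b, HasDerivAt c (c' t) t)
    (hθ : ∀ t ∈ Icc a b, HasDerivAt θ (θ' t) t) (hc0 : ∀ t ∈ Icc a b, 0 < c t)
    (hθI : ∀ t ∈ Icc a b, θ t ∈ I)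
    (hinit : ∀ x : En n, ‖x‖ = 1 → c a * suppFun (Ω (θ a)) x < suppFun (Ω a) x)
    (hsub : ∀ t ∈ Icc a b, ∀ x : En n, ‖x‖ = 1 →
      c' t * suppFun (Ω (θ t)) x + c t * ((flowSpeed n k p (Ω (θ t)) (u (θ t)) f x
          - etaFn n k p Ω u f (θ t) * suppFun (Ω (θ t)) x) * θ' t)
        < c t ^ (p + 3) * flowSpeed n k p (Ω (θ t)) (u (θ t)) f x
          - etaFn n k p Ω u f t * (c t * suppFun (Ω (θ t)) x)) :
    ∀ t ∈ Icc a b, ∀ x : En n, ‖x‖ = 1 → c t * suppFun (Ω (θ t)) x < suppFun (Ω t) x := by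
  intro t₁ ht₁ x₁ hx₁
  by_contra! hcon
  set F : ℝ × En n → ℝ := fun q => suppFun (Ω q.1) q.2 - c q.1 * suppFun (Ω (θ q.1)) q.2 with hF
  have hFc : ContinuousOn F (Icc a b ×ˢ Metric.sphere 0 1) := by
    have hcc : ContinuousOn c (Icc a b) := fun t ht => (hc t ht).continuousAt.continuousWithinAt
    have hθc : ContinuousOn θ (Icc a b) := fun t ht => (hθ t ht).continuousAt.continuousWithinAt
    have hfst : ContinuousOn (Prod.fst : ℝ × En n → ℝ) (Icc a b ×ˢ Metric.sphere 0 1) :=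
      continuous_fst.continuousOn
    refine (hcf.continuousOn.mono (prod_mono hab le_rfl)).sub
      ((hcc.comp hfst fun q hq => hq.1).mul ?_)
    exact hcf.continuousOn.comp (f := fun q : ℝ × En n => (θ q.1, q.2))
      ((hθc.comp hfst fun q hq => hq.1).prodMk continuous_snd.continuousOn)
      fun q hq => ⟨hθI _ hq.1, hq.2⟩
  obtain ⟨t, ht, x, hxS, h0, hnn, hpos⟩ := exists_first_touching (isCompact_sphere (0 : En n) 1)
    hFc (fun x hx => sub_pos.mpr (hinit x (by simpa using hx))) ht₁
    (show x₁ ∈ Metric.sphere (0 : En n) 1 by simpa using hx₁) (sub_nonpos.mpr hcon)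
  have hx : ‖x‖ = 1 := by simpa using hxS
  have htI : t ∈ Icc a b := ⟨ht.1.le, ht.2⟩
  have heq : c t * suppFun (Ω (θ t)) x = suppFun (Ω t) x := (sub_eq_zero.mp h0).symm
  have hsp := flowSpeed_le_of_touching (p := p) hk1 hk (h.bodies _ (hθI t htI))
    (h.bodies t (hab htI)) (h.adm _ (hθI t htI)) (h.adm t (hab htI)) (hc0 t htI) hx (hf x hx)
    (fun z hz => sub_nonneg.mp (hnn z (by simpa using hz))) heq
  have hd1 := h.hasDerivAt (hab htI) hx
  have hd2 : HasDerivAt (fun s => suppFun (Ω (θ s)) x) _ t :=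
    HasDerivAt.comp t (h.hasDerivAt (hθI t htI) hx) (hθ t htI)
  have hd3 := hd1.sub ((hc t htI).mul hd2)
  have hle := hd3.nonpos_of_eventually_ge_left (by
    filter_upwards [Ioo_mem_nhdsLT ht.1] with s hs
    have h1 := hpos s ⟨hs.1.le, hs.2⟩ x hxS
    change F (t, x) ≤ F (s, x)
    rw [h0]
    exact h1.le)
  have h2 := hsub t htI x hx
  rw [← heq] at hle
  linarith

theorem exp_neg_mul_abs_le_rpow {q y L : ℝ} (hy : |y| ≤ L) : exp (-(|q| * L)) ≤ exp y ^ q := by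
  rw [← exp_mul]
  refine exp_le_exp.mpr ?_
  have h1 : |y * q| ≤ |q| * L := by
    rw [abs_mul, mul_comm]
    exact mul_le_mul_of_nonneg_left hy (abs_nonneg q)
  linarith [neg_abs_le (y * q)]

/-- After normalizing by `exp N`, the body has grown by a definite factor. -/
theorem IsFlowSolution.exp_mul_suppFun_zero_lt {n k : ℕ} {p T : ℝ} (hk1 : 1 ≤ k) (hk : k + 1 ≤ n)
    {Ω : ℝ → Set (En n)} {u : ℝ → En n → ℝ} {f : En n → ℝ}
    (h : IsFlowSolution n k p (Ico 0 T) Ω u f) {C : ℝ} (hcf : IsContinuousFamily n (Ico 0 T) Ω C)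
    (hf : ∀ x : En n, ‖x‖ = 1 → 0 < f x) {N : ℝ → ℝ}
    (hN : ∀ t ∈ Ico 0 T, HasDerivAt N (etaFn n k p Ω u f t) t) (hN0 : N 0 = 0)
    (hNC : ∀ t ∈ Ico 0 T, |N t| ≤ C * T) {c : ℝ} (hc0 : 0 < c) (hc1 : c ≤ 1)
    (hc : ∀ x : En n, ‖x‖ = 1 → c * suppFun (Ω 0) x <
      exp (-(|p + 2| * (2 * T + C * T))) * flowSpeed n k p (Ω 0) (u 0) f x)
    (hS : ∀ x : En n, ‖x‖ = 1 → 0 < flowSpeed n k p (Ω 0) (u 0) f x)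
    {s : ℝ} (hs0 : 0 < s) (hsT : s < T) {x : En n} (hx : ‖x‖ = 1) :
    exp (c * s / 2 - N s) * suppFun (Ω 0) x < suppFun (Ω s) x := by
  have hn : ∀ x : En n, ‖x‖ = 1 → 0 < suppFun (Ω 0) x := fun x hx =>
    suppFun_pos (h.bodies 0 ⟨le_rfl, hs0.trans hsT⟩).body (ne_zero_of_norm_eq_one hx)
  have hsub : Icc 0 s ⊆ Ico 0 T := fun t ht => ⟨ht.1, ht.2.trans_lt hsT⟩
  have h0I : (0 : ℝ) ∈ Ico 0 T := ⟨le_rfl, hs0.trans hsT⟩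
  have := h.mul_suppFun_lt hk1 hk hcf hf hsub (c := fun t => exp (c * t - N t - c * s / 2))
    (c' := fun t => exp (c * t - N t - c * s / 2) * (c - etaFn n k p Ω u f t))
    (θ := fun _ => 0) (θ' := fun _ => 0) (fun t ht => ?_) (fun t _ => hasDerivAt_const t 0)
    (fun t _ => exp_pos _) (fun _ _ => h0I) (fun x hx => ?_) (fun t ht x hx => ?_) s
    ⟨hs0.le, le_rfl⟩ x hx
  · convert this using 3
    ring
  · have h1 := (((hasDerivAt_id t).const_mul c).sub (hN t (hsub ht))).sub_const (c * s / 2)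
    simpa using h1.exp
  · have h1 : exp (c * 0 - N 0 - c * s / 2) < 1 := by
      rw [exp_lt_one_iff, hN0]
      nlinarith
    exact mul_lt_of_lt_one_left (hn x hx) h1
  · set l := c * t - N t - c * s / 2 with hl
    have habs : |l| ≤ 2 * T + C * T := by
      have h1 := abs_le.mp (hNC t (hsub ht))
      have h2 : c * t ≤ T := by nlinarith [ht.1, ht.2]
      have h3 : c * s ≤ T := by nlinarith
      have h4 : 0 ≤ c * t := mul_nonneg hc0.le ht.1
      have h5 : 0 ≤ c * s := mul_nonneg hc0.le hs0.le
      rw [abs_le]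
      constructor <;> linarith [h1.1, h1.2]
    have h1 := exp_neg_mul_abs_le_rpow (q := p + 2) habs
    have h2 : c * suppFun (Ω 0) x < exp l ^ (p + 2) * flowSpeed n k p (Ω 0) (u 0) f x :=
      (hc x hx).trans_le (mul_le_mul_of_nonneg_right h1 (hS x hx).le)
    have h3 : exp l ^ (p + 3) = exp l * exp l ^ (p + 2) := by
      rw [show p + 3 = 1 + (p + 2) by ring, rpow_add (exp_pos l), rpow_one]
    rw [h3]
    have := mul_lt_mul_of_pos_left h2 (exp_pos l)
    linarith

/-- A slightly dilated body at an earlier time stays inside the evolving body. -/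
theorem IsFlowSolution.exp_mul_suppFun_delay_lt {n k : ℕ} {p T : ℝ} (hk1 : 1 ≤ k)
    (hk : k + 1 ≤ n) {Ω : ℝ → Set (En n)} {u : ℝ → En n → ℝ} {f : En n → ℝ}
    (h : IsFlowSolution n k p (Ico 0 T) Ω u f) {C : ℝ} (hcf : IsContinuousFamily n (Ico 0 T) Ω C)
    (hf : ∀ x : En n, ‖x‖ = 1 → 0 < f x) {N : ℝ → ℝ}
    (hN : ∀ t ∈ Ico 0 T, HasDerivAt N (etaFn n k p Ω u f t) t) (hN0 : N 0 = 0)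
    (hNC : ∀ t ∈ Ico 0 T, ∀ s ∈ Ico 0 T, |N t - N s| ≤ C * |t - s|)
    (hS : ∀ t ∈ Ico 0 T, ∀ x : En n, ‖x‖ = 1 → 0 < flowSpeed n k p (Ω t) (u t) f x)
    {c B s : ℝ} (hc0 : 0 < c) (hc1 : c ≤ 1) (hB0 : 0 < B) (hB : |p + 2| * (1 + C) < B)
    (hs0 : 0 < s) (hsB : s * B * exp (B * T) ≤ 1)
    (hinit : ∀ x : En n, ‖x‖ = 1 → exp (c * s / 2 - N s) * suppFun (Ω 0) x < suppFun (Ω s) x)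
    {t : ℝ} (hst : s ≤ t) (htT : t < T) {x : En n} (hx : ‖x‖ = 1) :
    t - s * exp (B * (t - s)) ∈ Ico 0 T ∧
    exp (c * s / 2 + N (t - s * exp (B * (t - s))) - N t) *
      suppFun (Ω (t - s * exp (B * (t - s)))) x < suppFun (Ω t) x := by
  have hsub : Icc s t ⊆ Ico 0 T := fun r hr => ⟨hs0.le.trans hr.1, hr.2.trans_lt htT⟩
  have hC := hcf.nonneg
  set θ : ℝ → ℝ := fun r => r - s * exp (B * (r - s)) with hθ
  have hθI : ∀ r ∈ Icc s t, θ r ∈ Ico 0 T := by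
    intro r hr
    have hE := exp_pos (B * (r - s))
    refine ⟨?_, ?_⟩
    · have h1 : exp (B * (r - s)) * (1 - B * (r - s)) ≤ 1 := by
        have := mul_le_mul_of_nonneg_left (one_sub_le_exp_neg (B * (r - s))) hE.le
        rwa [← exp_add, add_neg_cancel, exp_zero] at this
      have h2 : s * B * exp (B * (r - s)) ≤ 1 := by
        refine le_trans (mul_le_mul_of_nonneg_left (exp_le_exp.mpr ?_) (by positivity)) hsB
        refine mul_le_mul_of_nonneg_left ?_ hB0.le
        linarith [hr.2]
      have h3 := mul_le_mul_of_nonneg_right h2 (sub_nonneg.mpr hr.1)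
      have h4 := mul_le_mul_of_nonneg_left h1 hs0.le
      simp only [hθ]
      linarith
    · have := mul_pos hs0 hE
      simp only [hθ]
      linarith [hr.2]
  refine ⟨hθI t ⟨hst, le_rfl⟩, ?_⟩
  have hθd : ∀ r, HasDerivAt θ (1 - s * (exp (B * (r - s)) * B)) r := by
    intro r
    have h1 := (((hasDerivAt_id r).sub_const s).const_mul B).exp.const_mul s
    exact ((hasDerivAt_id r).sub h1).congr_deriv (by simp)
  refine h.mul_suppFun_lt hk1 hk hcf hf hsub (c := fun r => exp (c * s / 2 + N (θ r) - N r))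
    (c' := fun r => exp (c * s / 2 + N (θ r) - N r) *
      (etaFn n k p Ω u f (θ r) * (1 - s * (exp (B * (r - s)) * B)) - etaFn n k p Ω u f r))
    (θ := θ) (fun r hr => ?_) (fun r _ => hθd r)
    (fun t _ => exp_pos _) hθI (fun x hx => ?_) (fun r hr x hx => ?_) t
    ⟨hst, le_rfl⟩ x hx
  · have h1 : HasDerivAt (fun r => N (θ r)) _ r := (hN _ (hθI r hr)).comp r (hθd r)
    exact ((h1.const_add (c * s / 2)).sub (hN r (hsub hr))).exp
  · have h0 : θ s = 0 := by simp [hθ]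
    simpa only [h0, hN0, add_zero] using hinit x hx
  · set l := c * s / 2 + N (θ r) - N r with hl
    set E := exp (B * (r - s)) with hE
    have hE1 : 1 ≤ E := one_le_exp (mul_nonneg hB0.le (sub_nonneg.mpr hr.1))
    have hsE : s ≤ s * E := le_mul_of_one_le_right hs0.le hE1
    have habs : |l| ≤ (1 + C) * (s * E) := by
      have h1 := hNC _ (hθI r hr) _ (hsub hr)
      have h2 : |θ r - r| = s * E := by
        simp only [hθ, sub_sub_cancel_left, abs_neg]
        exact abs_of_pos (by positivity)
      rw [h2] at h1
      have h1 := abs_le.mp h1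
      have h3 : c * s ≤ s := mul_le_of_le_one_left hs0.le hc1
      have h5 : 0 ≤ c * s := mul_nonneg hc0.le hs0.le
      rw [abs_le]
      constructor <;> linarith [h1.1, h1.2]
    have h1 := exp_neg_mul_abs_le_rpow (q := p + 2) habs
    have h2 : 1 - s * (E * B) < exp l ^ (p + 2) := by
      refine lt_of_lt_of_le ?_ ((one_sub_le_exp_neg _).trans h1)
      have := mul_lt_mul_of_pos_right hB (show 0 < s * E by positivity)
      linarith
    have h3 : exp l ^ (p + 3) = exp l * exp l ^ (p + 2) := by
      rw [show p + 3 = 1 + (p + 2) by ring, rpow_add (exp_pos l), rpow_one]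
    rw [h3]
    have := mul_lt_mul_of_pos_left (mul_lt_mul_of_pos_right h2 (hS _ (hθI r hr) x hx)) (exp_pos l)
    linarith

theorem IsFlowSolution.le_flowSpeed {n k : ℕ} {p T : ℝ} (hk1 : 1 ≤ k)
    (hk : k + 1 ≤ n) {Ω : ℝ → Set (En n)} {u : ℝ → En n → ℝ} {f : En n → ℝ}
    (h : IsFlowSolution n k p (Ico 0 T) Ω u f) {C : ℝ} (hcf : IsContinuousFamily n (Ico 0 T) Ω C)
    (hf : ∀ x : En n, ‖x‖ = 1 → 0 < f x) {N : ℝ → ℝ}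
    (hN : ∀ t ∈ Ico 0 T, HasDerivAt N (etaFn n k p Ω u f t) t) (hN0 : N 0 = 0)
    (hNC : ∀ t ∈ Ico 0 T, ∀ s ∈ Ico 0 T, |N t - N s| ≤ C * |t - s|)
    (hS : ∀ t ∈ Ico 0 T, ∀ x : En n, ‖x‖ = 1 → 0 < flowSpeed n k p (Ω t) (u t) f x)
    {m M : ℝ} (hm0 : 0 < m) (hm : ∀ x : En n, ‖x‖ = 1 → m ≤ flowSpeed n k p (Ω 0) (u 0) f x)
    (hM0 : 0 < M) (hM : ∀ x : En n, ‖x‖ = 1 → suppFun (Ω 0) x ≤ M) :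
    ∃ d > 0, ∀ t ∈ Ioo 0 T, ∀ x : En n, ‖x‖ = 1 →
      d * suppFun (Ω t) x ≤ flowSpeed n k p (Ω t) (u t) f x := by
  have hC := hcf.nonneg
  set K := exp (-(|p + 2| * (2 * T + C * T))) with hK
  obtain ⟨c, hc0, hc1, hcM⟩ : ∃ c, 0 < c ∧ c ≤ 1 ∧ c * M < K * m := by
    have hKm : 0 < K * m := mul_pos (exp_pos _) hm0
    refine ⟨min 1 (K * m / (2 * M)), by positivity, min_le_left _ _, ?_⟩
    refine (mul_le_mul_of_nonneg_right (min_le_right _ _) hM0.le).trans_lt ?_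
    rw [div_mul_eq_mul_div, div_lt_iff₀ (by positivity)]
    nlinarith [mul_pos hKm hM0]
  have hcH : ∀ z : En n, ‖z‖ = 1 → c * suppFun (Ω 0) z < K * flowSpeed n k p (Ω 0) (u 0) f z :=
    fun z hz => (mul_le_mul_of_nonneg_left (hM z hz) hc0.le).trans_lt
      (hcM.trans_le (mul_le_mul_of_nonneg_left (hm z hz) (exp_pos _).le))
  set B := |p + 2| * (1 + C) + 1 with hB
  have hB0 : 0 < B := by positivity
  refine ⟨c / 2 * exp (-(B * T)), by positivity, fun t ht x hx => ?_⟩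
  have htI : t ∈ Ico 0 T := ⟨ht.1.le, ht.2⟩
  have h0I : (0 : ℝ) ∈ Ico 0 T := ⟨le_rfl, ht.1.trans ht.2⟩
  have hN0T : ∀ t ∈ Ico 0 T, |N t| ≤ C * T := by
    intro t ht
    have := hNC t ht 0 h0I
    rw [hN0, sub_zero, sub_zero, abs_of_nonneg ht.1] at this
    exact this.trans (mul_le_mul_of_nonneg_left ht.2.le hC)
  set θ : ℝ → ℝ := fun s => t - s * exp (B * (t - s)) with hθ
  set Φ : ℝ → ℝ := fun r => exp (N r) * suppFun (Ω r) x with hΦ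
  have hΦd : HasDerivAt Φ (exp (N t) * flowSpeed n k p (Ω t) (u t) f x) t := by
    exact ((hN t htI).exp.mul (h.hasDerivAt htI hx)).congr_deriv (by ring)
  have hθt : Tendsto θ (𝓝[>] 0) (𝓝[≠] t) := by
    refine tendsto_nhdsWithin_iff.mpr ⟨?_, ?_⟩
    · have : Continuous θ := by fun_prop
      have h1 := this.tendsto 0
      simp only [hθ, zero_mul, sub_zero] at h1
      exact h1.mono_left nhdsWithin_le_nhds
    · filter_upwards [eventually_mem_nhdsWithin] with s hs
      have : 0 < s * exp (B * (t - s)) := mul_pos hs (exp_pos _)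
      simp only [hθ, mem_compl_iff, mem_singleton_iff]
      intro h
      linarith
  have h1 := (hasDerivAt_iff_tendsto_slope.mp hΦd).comp hθt
  have h2 : Tendsto (fun s => c / 2 * exp (-(B * T)) * Φ (θ s)) (𝓝[>] 0)
      (𝓝 (c / 2 * exp (-(B * T)) * Φ t)) :=
    (hΦd.continuousAt.tendsto.comp (hθt.mono_right nhdsWithin_le_nhds)).const_mul _
  have h3 : c / 2 * exp (-(B * T)) * Φ t ≤ exp (N t) * flowSpeed n k p (Ω t) (u t) f x := by
    refine le_of_tendsto_of_tendsto h2 h1 ?_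
    have hδ : 0 < min t (1 / (B * exp (B * T))) := lt_min ht.1 (by positivity)
    filter_upwards [Ioo_mem_nhdsGT hδ] with s hs
    have hst : s < t := hs.2.trans_le (min_le_left _ _)
    have hsB : s * B * exp (B * T) ≤ 1 := by
      have := (hs.2.trans_le (min_le_right _ _)).le
      rw [le_div_iff₀ (by positivity)] at this
      linarith
    obtain ⟨hI, hlt⟩ := h.exp_mul_suppFun_delay_lt hk1 hk hcf hf hN hN0 hNC hS hc0 hc1 hB0
      (by linarith) hs.1 hsB (fun y hy => h.exp_mul_suppFun_zero_lt hk1 hk hcf hf hN hN0 hN0T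
        hc0 hc1 hcH (hS 0 h0I) hs.1 (hst.trans ht.2) hy) hst.le ht.2 hx
    change θ s ∈ _ at hI
    change exp (c * s / 2 + N (θ s) - N t) * suppFun (Ω (θ s)) x < _ at hlt
    set E := exp (B * (t - s)) with hE
    have hEpos : 0 < E := exp_pos _
    have hE2 : exp (-(B * T)) * E ≤ 1 := by
      rw [hE, ← exp_add, exp_le_one_iff]
      nlinarith [hs.1, ht.2]
    have hΦ0 : 0 ≤ Φ (θ s) := mul_nonneg (exp_pos _).le
      (suppFun_pos (h.bodies _ hI).body (ne_zero_of_norm_eq_one hx)).le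
    have hgrow : (1 + c * s / 2) * Φ (θ s) ≤ Φ t := by
      have h4 := mul_lt_mul_of_pos_left hlt (exp_pos (N t))
      rw [← mul_assoc, ← exp_add, show N t + (c * s / 2 + N (θ s) - N t) = c * s / 2 + N (θ s)
        by ring, exp_add, mul_assoc] at h4
      refine (mul_le_mul_of_nonneg_right ?_ hΦ0).trans h4.le
      linarith [add_one_le_exp (c * s / 2)]
    have hd : θ s - t = -(s * E) := by simp only [hθ, hE]; ring
    have hsE : 0 < s * E := mul_pos hs.1 hEpos
    change _ ≤ slope Φ t (θ s)
    rw [slope_def_field, hd, div_neg, ← neg_div, neg_sub, le_div_iff₀ hsE]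
    have h5 := mul_le_mul_of_nonneg_left hE2 (show 0 ≤ c * s / 2 * Φ (θ s) by
      have := hs.1; positivity)
    linarith
  rw [hΦ] at h3
  have h4 : exp (N t) * (c / 2 * exp (-(B * T)) * suppFun (Ω t) x) ≤
      exp (N t) * flowSpeed n k p (Ω t) (u t) f x := by linarith
  exact le_of_mul_le_mul_left h4 (exp_pos _)

theorem exists_antiderivative_of_continuousOn_Ico {T : ℝ} {g : ℝ → ℝ}
    (hg : ContinuousOn g (Ico 0 T)) :
    ∃ N : ℝ → ℝ, N 0 = 0 ∧ ∀ t ∈ Ico 0 T, HasDerivAt N (g t) t := by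
  have hc : ContinuousOn (fun s => g (max s 0)) (Iio T) := by
    rcases le_or_gt T 0 with hT | hT
    · have : EqOn (fun s => g (max s 0)) (fun _ => g 0) (Iio T) := fun s hs => by
        simp [max_eq_right ((le_of_lt hs).trans hT)]
      exact continuousOn_const.congr this
    · exact hg.comp (by fun_prop) fun s hs => ⟨le_max_right _ _, max_lt hs hT⟩
  refine ⟨fun t => ∫ s in (0 : ℝ)..t, g (max s 0), by simp, fun t ht => ?_⟩
  have hsub : uIcc 0 t ⊆ Iio T := by
    rw [uIcc_of_le ht.1]
    exact fun s hs => hs.2.trans_lt ht.2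
  have h1 := intervalIntegral.integral_hasDerivAt_right
    (hc.mono hsub).intervalIntegrable
    (hc.stronglyMeasurableAtFilter isOpen_Iio t ht.2) (hc.continuousAt (Iio_mem_nhds ht.2))
  simpa only [max_eq_left ht.1] using h1

theorem continuous_esym (n k : ℕ) : Continuous (esym n k) := by
  have h : ∀ A : Matrix (Fin n) (Fin n) ℝ, esym n k A = (-1 : ℝ) ^ k *
      MvPolynomial.eval (fun q : Fin n × Fin n => A q.1 q.2)
        ((Matrix.charpoly.univ ℝ (Fin n)).coeff (n - k)) := by
    intro A
    rw [esym]
    congr 1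
    exact (Matrix.charpoly.univ_coeff_eval₂Hom (Fin n) (RingHom.id ℝ)
      (fun q : Fin n × Fin n => A q.1 q.2) (n - k)).symm
  rw [funext h]
  refine continuous_const.mul ((MvPolynomial.continuous_eval _).comp ?_)
  fun_prop

theorem continuousAt_hessMat {n : ℕ} {w : En n → ℝ} {y : En n} (hw : ContDiffAt ℝ 2 w y) :
    ContinuousAt (hessMat w) y := by
  have h : ContinuousAt (fderiv ℝ (fderiv ℝ w)) y :=
    ((hw.fderiv_right (m := 1) (by norm_num)).fderiv_right (m := 0) (by norm_num)).continuousAt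
  refine continuousAt_pi.mpr fun i => continuousAt_pi.mpr fun j => ?_
  simp only [hessMat_apply]
  exact (h.clm_apply continuousAt_const).clm_apply continuousAt_const

theorem IsSmoothStrictlyConvexBody.esym_hessMat_pos {n k : ℕ} (hk1 : 1 ≤ k) (hk : k + 1 ≤ n)
    {Ω : Set (En n)} (h : IsSmoothStrictlyConvexBody n Ω) {x : En n} (hx : ‖x‖ = 1) :
    0 < esym n (n - k) (hessMat (suppFun Ω) x) :=
  esym_pos_of_posSemidef (by omega) (posSemidef_hessMat_suppFun h (ne_zero_of_norm_eq_one hx)) x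
    fun ξ hξ hξ0 => by
      rw [dotProduct_mulVec_eq_quadForm]
      exact h.strictConv x hx ξ hξ hξ0

theorem exists_pos_le_of_continuousOn_sphere {n : ℕ} {g : En n → ℝ}
    (hg : ContinuousOn g (Metric.sphere 0 1)) (hpos : ∀ x : En n, ‖x‖ = 1 → 0 < g x) :
    ∃ m > 0, ∀ x : En n, ‖x‖ = 1 → m ≤ g x := by
  obtain ⟨m, hm, h⟩ := (isCompact_sphere (0 : En n) 1).exists_forall_le' hg (a := 0)
    fun x hx => hpos x (by simpa using hx)
  exact ⟨m, hm, fun x hx => h x (by simpa using hx)⟩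

theorem inv_rpow_abs_le_rpow {C r a : ℝ} (hC : 0 < C) (h1 : 1 / C ≤ r) (h2 : r ≤ C) :
    (C ^ |a|)⁻¹ ≤ r ^ a := by
  have hr : 0 < r := (by positivity : 0 < 1 / C).trans_le h1
  have h := rpow_le_rpow_abs (a := -a) hC h1 h2
  rw [abs_neg, rpow_neg hr.le] at h
  exact inv_le_of_inv_le₀ (rpow_pos_of_pos hr a) h

theorem norm_gradient_suppFun_mem_Icc {n : ℕ} {Ω : Set (En n)}
    (h : IsSmoothStrictlyConvexBody n Ω) {C : ℝ} (hC : 0 ≤ C)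
    (hle : ∀ x : En n, ‖x‖ = 1 → suppFun Ω x ≤ C) {x : En n} (hx : ‖x‖ = 1) :
    ‖gradient (suppFun Ω) x‖ ∈ Icc (suppFun Ω x) C := by
  obtain ⟨hm, hi⟩ := gradient_suppFun_mem h (ne_zero_of_norm_eq_one hx)
  refine ⟨?_, norm_le_of_mem_of_suppFun_le h.body hC hle hm⟩
  have := real_inner_le_norm x (gradient (suppFun Ω) x)
  rwa [hi, hx, one_mul] at this

theorem norm_gradient_le_of_norm_iteratedFDeriv_le {n : ℕ} {Ω : Set (En n)}
    (hΩ : Convex ℝ Ω) {w : En n → ℝ} (hw : ∀ y, ContDiffAt ℝ 2 w y) {C : ℝ} (hC : 0 ≤ C)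
    (hd : ∀ y ∈ Ω, ‖iteratedFDeriv ℝ 2 w y‖ ≤ C) {R : ℝ} (hR : ∀ y ∈ Ω, ‖y‖ ≤ R)
    {y₀ : En n} (hy₀ : y₀ ∈ Ω) (hg : ‖gradient w y₀‖ ≤ C) {y : En n} (hy : y ∈ Ω) :
    ‖gradient w y‖ ≤ C + C * (2 * R) := by
  have h1 := norm_gradient_sub_le w y₀ y
  have h2 := norm_fderiv_sub_le_of_convex hΩ hw hd hy₀ hy
  have h3 : ‖y - y₀‖ ≤ 2 * R := (norm_sub_le _ _).trans (by linarith [hR y hy, hR y₀ hy₀])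
  have h4 := norm_le_norm_add_norm_sub' (gradient w y) (gradient w y₀)
  have h5 := mul_le_mul_of_nonneg_left h3 hC
  linarith

/-- Two-sided bounds on the coefficient of the curvature function in the flow speed. -/
theorem exists_flowSpeed_bounds {k : ℕ} {p C : ℝ} (hC : 0 < C) {n : ℕ} {f : En n → ℝ}
    (hfpos : ∀ x : En n, ‖x‖ = 1 → 0 < f x) (hf : ContinuousOn f (Metric.sphere 0 1)) :
    ∃ g > 0, ∃ G > 0, ∀ (Ω : Set (En n)) (u : En n → ℝ) (x : En n), ‖x‖ = 1 →
      suppFun Ω x ∈ Icc (1 / C) C → ‖gradient (suppFun Ω) x‖ ∈ Icc (1 / C) C →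
      ‖gradient u (gradient (suppFun Ω) x)‖ ∈ Icc (1 / C) C →
      0 ≤ esym n (n - k) (hessMat (suppFun Ω) x) →
      g * esym n (n - k) (hessMat (suppFun Ω) x) ≤ flowSpeed n k p Ω u f x ∧
        flowSpeed n k p Ω u f x ≤ G * esym n (n - k) (hessMat (suppFun Ω) x) := by
  obtain ⟨a, ha, hfa⟩ := exists_pos_le_of_continuousOn_sphere hf hfpos
  obtain ⟨b, hb, hfb⟩ := exists_pos_le_of_continuousOn_sphere (g := fun x => (f x)⁻¹)
    (hf.inv₀ fun x hx => (hfpos x (by simpa using hx)).ne') fun x hx => inv_pos.mpr (hfpos x hx)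
  refine ⟨(1 / C) ^ 2 * b * (C ^ |p - (n : ℝ)|)⁻¹ * (1 / C) ^ (k + 1), by positivity,
    C ^ 2 * a⁻¹ * C ^ |p - (n : ℝ)| * C ^ (k + 1), by positivity, ?_⟩
  intro Ω u x hx hH hr hu hσ
  have hC' : 0 < 1 / C := by positivity
  have hfx := hfpos x hx
  have hH0 : 0 ≤ suppFun Ω x := hC'.le.trans hH.1
  have h1 := inv_rpow_abs_le_rpow (a := p - (n : ℝ)) hC hr.1 hr.2
  have h2 := rpow_le_rpow_abs (a := p - (n : ℝ)) hC hr.1 hr.2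
  have h3 := hfb x hx
  have h4 := inv_anti₀ ha (hfa x hx)
  have h5 := hH.1
  have h6 := hH.2
  have h7 := hu.1
  have h8 := hu.2
  rw [flowSpeed, div_eq_mul_inv (suppFun Ω x ^ 2)]
  constructor
  · refine mul_le_mul_of_nonneg_right ?_ hσ
    gcongr
  · refine mul_le_mul_of_nonneg_right ?_ hσ
    gcongr

/-- **Lower bound for `σ_{n-k}` (Lemma 5.5).** For `p < n-2`, along a smooth strictly
convex solution of the flow with uniform two-sided bounds on `h`, `ρ`, `|∇h|`, `η(t)`,
`|Du|` and `|D²u|`, the curvature function `σ_{n-k}(h_{ij}+hδ_{ij}) = S_{n-k}(D²H)`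
(with `H` the 1-homogeneous extension of the support function) is bounded below by a
positive constant independent of `t`. -/
theorem sigma_lower_bound_along_flow (n k : ℕ) (p T C₀ : ℝ) (hk1 : 1 ≤ k)
    (hkn : k ≤ n - 1) (hp : p < (n : ℝ) - 2) (hC₀ : 0 < C₀)
    (Ω : ℝ → Set (En n)) (u : ℝ → En n → ℝ) (f : En n → ℝ)
    (hfpos : ∀ x : En n, ‖x‖ = 1 → 0 < f x)
    (hfsm : ContDiffOn ℝ (⊤ : ℕ∞) f {(0 : En n)}ᶜ)
    (hflow : IsFlowSolution n k p (Set.Ico 0 T) Ω u f)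
    (hbnd : ∀ t ∈ Set.Ico (0 : ℝ) T, ∀ x : En n, ‖x‖ = 1 →
      (1 / C₀ ≤ suppFun (Ω t) x ∧ suppFun (Ω t) x ≤ C₀) ∧
      (1 / C₀ ≤ radialFun (Ω t) x ∧ radialFun (Ω t) x ≤ C₀) ∧
      ‖gradient (suppFun (Ω t)) x - suppFun (Ω t) x • x‖ ≤ C₀ ∧
      (1 / C₀ ≤ ‖gradient (u t) (gradient (suppFun (Ω t)) x)‖ ∧
        ‖gradient (u t) (gradient (suppFun (Ω t)) x)‖ ≤ C₀))
    (heta : ∀ t ∈ Set.Ico (0 : ℝ) T,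
      1 / C₀ ≤ etaFn n k p Ω u f t ∧ etaFn n k p Ω u f t ≤ C₀)
    (hD2u : ∀ t ∈ Set.Ico (0 : ℝ) T, ∀ y ∈ Ω t, ‖iteratedFDeriv ℝ 2 (u t) y‖ ≤ C₀)
    :
    ∃ C > (0 : ℝ), ∀ t ∈ Set.Ico (0 : ℝ) T, ∀ x : En n, ‖x‖ = 1 →
      C ≤ esym n (n - k) (hessMat (suppFun (Ω t)) x) := by
  rcases le_or_gt T 0 with hT | hT
  · exact ⟨1, one_pos, fun t ht => absurd (ht.1.trans_lt ht.2) (not_lt.mpr hT)⟩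
  have hk : k + 1 ≤ n := by omega
  have h0 : (0 : ℝ) ∈ Ico 0 T := ⟨le_rfl, hT⟩
  have hinv : 0 < 1 / C₀ := by positivity
  have hsphere : Metric.sphere (0 : En n) 1 ⊆ {0}ᶜ := fun x hx =>
    ne_zero_of_norm_eq_one (by simpa using hx)
  have hcf := hflow.isContinuousFamily hC₀.le fun t ht x hx => (hbnd t ht x hx).1.2
  have hηpos : ∀ t ∈ Ico 0 T, 0 < etaFn n k p Ω u f t := fun t ht => hinv.trans_le (heta t ht).1
  have hM : ∀ t ∈ Ico 0 T, ∀ y ∈ Ω t, ‖gradient (u t) y‖ ≤ C₀ + C₀ * (2 * C₀) := by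
    intro t ht y hy
    have hb := hflow.bodies t ht
    have he : ‖(EuclideanSpace.single ⟨0, by omega⟩ 1 : En n)‖ = 1 := by simp
    exact norm_gradient_le_of_norm_iteratedFDeriv_le hb.body.conv
      (fun y => (hflow.adm t ht).contDiffAt y) hC₀.le (hD2u t ht)
      (fun y => norm_le_of_mem_of_suppFun_le hb.body hC₀.le fun x hx => (hbnd t ht x hx).1.2)
      (gradient_suppFun_mem hb (ne_zero_of_norm_eq_one he)).1 (hbnd t ht _ he).2.2.2.2 hy
  have hηc := hcf.continuousOn_etaFn hk1 hk hC₀ hflow.adm hC₀.le hD2u hM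
    (fun t ht x hx => (hbnd t ht x hx).2.1) hηpos
  obtain ⟨N, hN0, hN⟩ := exists_antiderivative_of_continuousOn_Ico hηc
  have hNC : ∀ t ∈ Ico 0 T, ∀ s ∈ Ico 0 T, |N t - N s| ≤ C₀ * |t - s| := by
    intro t ht s hs
    refine (convex_Ico 0 T).norm_image_sub_le_of_norm_hasDerivWithin_le
      (fun r hr => (hN r hr).hasDerivWithinAt) (fun r hr => ?_) hs ht
    rw [Real.norm_of_nonneg (hηpos r hr).le]
    exact (heta r hr).2
  have hσ : ∀ t ∈ Ico 0 T, ∀ x : En n, ‖x‖ = 1 →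
      0 < esym n (n - k) (hessMat (suppFun (Ω t)) x) :=
    fun t ht x hx => (hflow.bodies t ht).esym_hessMat_pos hk1 hk hx
  obtain ⟨g, hg, G, hG, hgG⟩ := exists_flowSpeed_bounds (k := k) (p := p) hC₀ hfpos
    (hfsm.continuousOn.mono hsphere)
  have hbd : ∀ t ∈ Ico 0 T, ∀ x : En n, ‖x‖ = 1 →
      g * esym n (n - k) (hessMat (suppFun (Ω t)) x) ≤ flowSpeed n k p (Ω t) (u t) f x ∧
      flowSpeed n k p (Ω t) (u t) f x ≤ G * esym n (n - k) (hessMat (suppFun (Ω t)) x) := by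
    intro t ht x hx
    have h1 := hbnd t ht x hx
    have h2 := norm_gradient_suppFun_mem_Icc (hflow.bodies t ht) hC₀.le
      (fun x hx => (hbnd t ht x hx).1.2) hx
    exact hgG _ _ x hx h1.1 ⟨h1.1.1.trans h2.1, h2.2⟩ h1.2.2.2 (hσ t ht x hx).le
  obtain ⟨m, hm, hm0⟩ := exists_pos_le_of_continuousOn_sphere
    (g := fun x => esym n (n - k) (hessMat (suppFun (Ω 0)) x))
    ((continuous_esym n (n - k)).comp_continuousOn fun x hx =>
      (continuousAt_hessMat ((hflow.bodies 0 h0).contDiffAt (hsphere hx))).continuousWithinAt)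
    (hσ 0 h0)
  obtain ⟨d, hd, hdS⟩ := hflow.le_flowSpeed hk1 hk hcf hfpos hN hN0 hNC
    (fun t ht x hx => (mul_pos hg (hσ t ht x hx)).trans_le (hbd t ht x hx).1)
    (mul_pos hg hm) (fun x hx => (mul_le_mul_of_nonneg_left (hm0 x hx) hg.le).trans
      (hbd 0 h0 x hx).1) hC₀ fun x hx => (hbnd 0 h0 x hx).1.2
  refine ⟨min m (d * (1 / C₀) / G), by positivity, fun t ht x hx => ?_⟩
  rcases ht.1.eq_or_lt with rfl | ht0
  · exact (min_le_left _ _).trans (hm0 x hx)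
  · refine (min_le_right _ _).trans ((div_le_iff₀ hG).mpr ?_)
    rw [mul_comm _ G]
    exact (mul_le_mul_of_nonneg_left (hbnd t ht x hx).1.1 hd.le).trans
      ((hdS t ⟨ht0, ht.2⟩ x hx).trans (hbd t ht x hx).2)
end
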